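/- Let f₁ ∈ ℂ[x,y,z] be a nonzero linear form and let f₂ ∈ ℂ[x,y,z] be an irreducible homogeneous polynomial of degree 2 (so that V(f₂) is a smooth conic). Let r ≥ 0 and let [a₀:b₀], …, [a_r:b_r] ∈ ℙ¹ be distinct points such that for each i the quadratic form a_i·f₂ + b_i·f₁² is nondegenerate, i.e., each member C_i = V(a_i·f₂ + b_i·f₁²) of the pencil F = [f₂ : f₁²] is a smooth conic. Then, setting C = C₀ ∪ ⋯ ∪ C_r, one has π₁(ℙ² \ C) ≅ 𝔽_r * ℤ₂. -/

import Mathlib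

open MvPolynomial

noncomputable section

/-- The complex projective plane, as the projectivization of `ℂ³`. -/
abbrev P2 : Type := Projectivization ℂ (Fin 3 → ℂ)

/-- The complex projective line, as the projectivization of `ℂ²`. -/
abbrev P1 : Type := Projectivization ℂ (Fin 2 → ℂ)

instance : TopologicalSpace P2 :=
  inferInstanceAs (TopologicalSpace (Quotient (projectivizationSetoid ℂ (Fin 3 → ℂ))))

instance : TopologicalSpace P1 :=
  inferInstanceAs (TopologicalSpace (Quotient (projectivizationSetoid ℂ (Fin 2 → ℂ))))

/-- The zero locus in `ℙ²` of a homogeneous polynomial `g ∈ ℂ[x,y,z]`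
(for homogeneous `g` the vanishing of `g` at the chosen representative `x.rep`
is independent of the choice of representative). -/
def V (g : MvPolynomial (Fin 3) ℂ) : Set P2 :=
  {x | eval x.rep g = 0}

/-- The point `[a:b] ∈ ℙ¹`. -/
def pt (a b : ℂ) (hab : ![a, b] ≠ 0) : P1 := Projectivization.mk ℂ ![a, b] hab

section PartA
open Set Topology unitInterval

/-- Induction principle for homotopy classes of paths: a property closed under concatenation
which holds for all paths inside small open sets holds for all paths. -/
theorem path_class_induction {X : Type*} [TopologicalSpace X]
    (P : ∀ x y : X, Path.Homotopic.Quotient x y → Prop)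
    (htrans : ∀ x y z (p : Path.Homotopic.Quotient x y) (q : Path.Homotopic.Quotient y z),
      P x y p → P y z q → P x z (p.trans q))
    (hloc : ∀ x : X, ∃ N : Set X, IsOpen N ∧ x ∈ N ∧
      ∀ (a b : X) (p : Path a b), range p ⊆ N → P a b (.mk p))
    (a b : X) (q : Path.Homotopic.Quotient a b) : P a b q := by
  induction q using Path.Homotopic.Quotient.ind with
  | mk γ =>
  choose N hNo hxN hN using hloc
  obtain ⟨t, ht0, htm, ⟨n, htn⟩, htc⟩ := exists_monotone_Icc_subset_open_cover_unitInterval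
    (c := fun x => γ ⁻¹' (N x)) (fun x => (hNo x).preimage γ.continuous)
    (fun s _ => mem_iUnion.2 ⟨γ s, hxN _⟩)
  have hcast : ∀ (a b a' b' : X) (h : a' = a) (h' : b' = b) (γ : Path a b),
      P a' b' (.mk (γ.cast h h')) → P a b (.mk γ) := by
    rintro a b _ _ rfl rfl γ h
    exact h
  have key : ∀ k, P _ _ (.mk (γ.subpath 0 (t k))) := by
    intro k
    induction k with
    | zero =>
      rw [ht0]
      refine hN (γ 0) _ _ _ ?_
      rw [Path.range_subpath]
      simp only [uIcc_self, image_singleton, singleton_subset_iff]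
      exact hxN _
    | succ k ih =>
      have h2 : P _ _ (.mk (γ.subpath (t k) (t (k+1)))) := by
        obtain ⟨x, hx⟩ := htc k
        refine hN x _ _ _ ?_
        rw [Path.range_subpath_of_le _ _ _ (htm (Nat.le_succ k))]
        rintro _ ⟨s, hs, rfl⟩
        exact hx hs
      have := htrans _ _ _ _ _ ih h2
      rw [← Path.Homotopic.Quotient.mk_trans] at this
      rw [← Path.Homotopic.Quotient.eq.2 ⟨Path.Homotopy.subpathTransSubpath γ 0 (t k) (t (k+1))⟩]
      exact this
  have := key n
  rw [htn n le_rfl, Path.subpath_zero_one] at this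
  exact hcast _ _ _ _ _ _ _ this

end PartA

section PartB
open Set Topology unitInterval

/-- The `G`-cover of `X` obtained by gluing copies of a chart `U` along an involution `τ`
of a part `W` of `U`, with transition function `h`. -/
theorem exists_glued_cover {X U G : Type} [TopologicalSpace X] [TopologicalSpace U] [T2Space U]
    [Group G] (π : U → X) (hπ : IsLocalHomeomorph π) (hsurj : Function.Surjective π)
    (W : Set U) (τ : U → U) (h : U → G)
    (hτW : ∀ u ∈ W, τ u ∈ W) (hττ : ∀ u ∈ W, τ (τ u) = u) (hτne : ∀ u ∈ W, τ u ≠ u)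
    (hτπ : ∀ u ∈ W, π (τ u) = π u)
    (hfib : ∀ u u', π u = π u' → u = u' ∨ (u ∈ W ∧ u' = τ u))
    (hloc : ∀ u ∈ W, ∀ᶠ u' in 𝓝 u, h u' = h u)
    (hinv : ∀ u ∈ W, h (τ u) = (h u)⁻¹) :
    ∃ (E : Type) (_ : TopologicalSpace E) (p : E → X) (_ : IsCoveringMap p) (j : U → G → E),
      (∀ g, Continuous (fun u => j u g)) ∧ (∀ u g, p (j u g) = π u) ∧
      (∀ u ∈ W, ∀ g, j u g = j (τ u) (h u * g)) ∧ (∀ u, Function.Injective (j u)) := by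
  classical
  let _ : TopologicalSpace G := ⊥
  have : DiscreteTopology G := ⟨rfl⟩
  choose e heu he using hπ
  have heπ : ∀ i u, e i u = π u := fun i u => by rw [← he i]
  choose idx hidx using hsurj
  have hs : ∀ i, ∀ x ∈ (e i).target, π ((e i).symm x) = x := fun i x hx => by
    rw [← heπ i]; exact (e i).right_inv hx
  have hmem : ∀ u, π u ∈ (e u).target := fun u => by
    rw [← heπ u]; exact (e u).map_source (heu u)
  have hsu : ∀ u, (e u).symm (π u) = u := fun u => by
    rw [← heπ u]; exact (e u).left_inv (heu u)
  -- the transition functions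
  let cc : U → U → X → G → G := fun i k x v =>
    if (e i).symm x = (e k).symm x then v else h ((e i).symm x) * v
  have hcomp : ∀ i j k, ∀ x ∈ (e i).target ∩ (e j).target ∩ (e k).target, ∀ v,
      cc j k x (cc i j x v) = cc i k x v := by
    rintro i j k x ⟨⟨hi, hj⟩, hk⟩ v
    have h1 := hfib ((e i).symm x) ((e j).symm x) (by rw [hs i x hi, hs j x hj])
    have h2 := hfib ((e j).symm x) ((e k).symm x) (by rw [hs j x hj, hs k x hk])
    simp only [cc]
    generalize (e i).symm x = a at *
    generalize (e j).symm x = b at *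
    generalize (e k).symm x = c at *
    by_cases hab : a = b
    · subst hab; simp
    · by_cases hbc : b = c
      · subst hbc; simp
      · obtain ⟨ha, rfl⟩ := h1.resolve_left hab
        obtain ⟨hb, rfl⟩ := h2.resolve_left hbc
        have := hττ a ha
        rw [this]
        simp [hab, hinv a ha, hτne a ha]
  let Z : FiberBundleCore U X G :=
    { baseSet := fun i => (e i).target
      isOpen_baseSet := fun i => (e i).open_target
      indexAt := idx
      mem_baseSet_at := fun x => by
        have := hmem (idx x); rwa [hidx] at this
      coordChange := cc
      coordChange_self := fun i x _ v => by simp [cc]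
      continuousOn_coordChange := by
        rintro i k ⟨x, g⟩ ⟨⟨hi, hk⟩, -⟩
        refine ContinuousAt.continuousWithinAt ?_
        have ci : ContinuousAt (e i).symm x := (e i).continuousAt_symm hi
        have ck : ContinuousAt (e k).symm x := (e k).continuousAt_symm hk
        have hi' : ∀ᶠ y in 𝓝 x, y ∈ (e i).target := (e i).open_target.mem_nhds hi
        have hk' : ∀ᶠ y in 𝓝 x, y ∈ (e k).target := (e k).open_target.mem_nhds hk
        by_cases hx : (e i).symm x = (e k).symm x
        · have : ∀ᶠ y in 𝓝 x, (e i).symm y = (e k).symm y := by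
            set u := (e i).symm x with hu
            have h1 : ∀ᶠ y in 𝓝 x, (e i).symm y ∈ (e u).source :=
              ci ((e u).open_source.mem_nhds (heu u))
            have h2 : ∀ᶠ y in 𝓝 x, (e k).symm y ∈ (e u).source := by
              refine ck ((e u).open_source.mem_nhds ?_)
              rw [← hx]; exact heu u
            filter_upwards [h1, h2, hi', hk'] with y y1 y2 yi yk
            apply (e u).injOn y1 y2
            rw [heπ, heπ, hs i y yi, hs k y yk]
          refine ContinuousAt.congr (f := fun p : X × G => p.2) continuousAt_snd ?_
          rw [nhds_prod_eq]
          filter_upwards [this.prod_inl (𝓝 g)] with p hp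
          simp [cc, hp]
        · have h1 : ∀ᶠ y in 𝓝 x, (e i).symm y ≠ (e k).symm y := 
            (ci.prodMk ck) (isClosed_diagonal.isOpen_compl.mem_nhds hx)
          have h2 := hfib ((e i).symm x) ((e k).symm x) (by rw [hs i x hi, hs k x hk])
          obtain ⟨hW, -⟩ := h2.resolve_left hx
          have h3 := ci.eventually (hloc _ hW)
          refine ContinuousAt.congr (f := fun p : X × G => h ((e i).symm x) * p.2)
            ((continuous_of_discreteTopology (f := fun v : G => h ((e i).symm x) * v)).continuousAt.comp
              continuousAt_snd) ?_
          rw [nhds_prod_eq]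
          filter_upwards [(h1.and h3).prod_inl (𝓝 g)] with p hp
          simp [cc, hp.1, hp.2]
      coordChange_comp := hcomp }
  have hidxm : ∀ u, π u ∈ (e (idx (π u))).target := fun u => Z.mem_baseSet_at (π u)
  refine ⟨Z.TotalSpace, inferInstance, Z.proj, FiberBundle.isCoveringMap,
    fun u g => ⟨π u, cc u (idx (π u)) (π u) g⟩, ?_, ?_, ?_, ?_⟩
  · intro g
    rw [continuous_iff_continuousAt]
    intro u0
    have hev : ∀ᶠ u in 𝓝 u0, u ∈ (e u0).source := (e u0).open_source.mem_nhds (heu u0)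
    have hc : ContinuousAt (fun u => (Z.localTriv u0).toOpenPartialHomeomorph.symm (π u, g)) u0 := by
      have h1 : ContinuousAt (Z.localTriv u0).toOpenPartialHomeomorph.symm (π u0, g) := by
        apply OpenPartialHomeomorph.continuousAt_symm
        rw [Z.mem_localTriv_target]
        exact hmem u0
      have h2 : ContinuousAt (fun u => (π u, g)) u0 := by
        refine ContinuousAt.prodMk ?_ continuousAt_const
        have := (e u0).continuousAt (heu u0)
        refine this.congr (Filter.Eventually.of_forall fun u => heπ _ _)
      exact ContinuousAt.comp (f := fun u => (π u, g)) h1 h2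
    refine hc.congr ?_
    filter_upwards [hev] with u hu
    rw [Z.localTriv_symm_apply]
    have hut : π u ∈ (e u0).target := by rw [← heπ u0]; exact (e u0).map_source hu
    have h1 : cc u u0 (π u) g = g := by
      have : (e u0).symm (π u) = u := by rw [← heπ u0]; exact (e u0).left_inv hu
      simp [cc, this, hsu]
    have h2 := hcomp u u0 (idx (π u)) (π u) ⟨⟨hmem u, hut⟩, hidxm u⟩ g
    rw [h1] at h2
    exact congrArg (fun t => (⟨π u, t⟩ : Z.TotalSpace)) h2
  · intro u g; rfl
  · intro u hu g
    have h1 : cc u (τ u) (π u) g = h u * g := by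
      have h3 := hsu (τ u)
      rw [hτπ u hu] at h3
      simp only [cc, hsu, h3]
      rw [if_neg (hτne u hu).symm]
    have hut : π u ∈ (e (τ u)).target := by have := hmem (τ u); rwa [hτπ u hu] at this
    have h2 := hcomp u (τ u) (idx (π u)) (π u) ⟨⟨hmem u, hut⟩, hidxm u⟩ g
    rw [h1] at h2
    have h4 : ∀ x', x' = π u → (⟨x', cc (τ u) (idx x') x' (h u * g)⟩ : Z.TotalSpace) =
        ⟨π u, cc (τ u) (idx (π u)) (π u) (h u * g)⟩ := by rintro _ rfl; rfl
    refine Eq.trans ?_ (h4 _ (hτπ u hu)).symm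
    exact congrArg (fun t => (⟨π u, t⟩ : Z.TotalSpace)) h2.symm
  · intro u g g' hg
    have h0 : cc u (idx (π u)) (π u) g = cc u (idx (π u)) (π u) g' := by
      have := congrArg (fun z : Z.TotalSpace => (z.2 : G)) hg
      exact this
    have h1 := hcomp u (idx (π u)) u (π u) ⟨⟨hmem u, hidxm u⟩, hmem u⟩ 
    have h2 : ∀ g, cc u u (π u) g = g := fun g => by simp [cc]
    rw [← h2 g, ← h2 g', ← h1, ← h1, h0]

end PartB

section PartC
open Set Topology unitInterval

section PathAlgebra
variable {X : Type} [TopologicalSpace X] {x y z w : X}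

theorem pq_assoc (p : Path.Homotopic.Quotient x y) (q : Path.Homotopic.Quotient y z)
    (s : Path.Homotopic.Quotient z w) : (p.trans q).trans s = p.trans (q.trans s) :=
  CategoryTheory.Category.assoc (obj := FundamentalGroupoid X) (W := ⟨x⟩) (X := ⟨y⟩) (Y := ⟨z⟩)
    (Z := ⟨w⟩) p q s

theorem pq_refl_trans (p : Path.Homotopic.Quotient x y) :
    (Path.Homotopic.Quotient.refl x).trans p = p :=
  CategoryTheory.Category.id_comp (obj := FundamentalGroupoid X) (X := ⟨x⟩) (Y := ⟨y⟩) p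

theorem pq_trans_refl (p : Path.Homotopic.Quotient x y) :
    p.trans (Path.Homotopic.Quotient.refl y) = p :=
  CategoryTheory.Category.comp_id (obj := FundamentalGroupoid X) (X := ⟨x⟩) (Y := ⟨y⟩) p

theorem pq_trans_symm (p : Path.Homotopic.Quotient x y) :
    p.trans p.symm = Path.Homotopic.Quotient.refl x :=
  CategoryTheory.Groupoid.comp_inv (obj := FundamentalGroupoid X) (X := ⟨x⟩) (Y := ⟨y⟩) p

theorem pq_symm_trans (p : Path.Homotopic.Quotient x y) :
    p.symm.trans p = Path.Homotopic.Quotient.refl y :=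
  CategoryTheory.Groupoid.inv_comp (obj := FundamentalGroupoid X) (X := ⟨x⟩) (Y := ⟨y⟩) p

theorem pq_symm_trans_cancel (p : Path.Homotopic.Quotient x y) (q : Path.Homotopic.Quotient y z) :
    p.symm.trans (p.trans q) = q := by
  rw [← pq_assoc, pq_symm_trans, pq_refl_trans]

theorem pq_trans_symm_cancel (p : Path.Homotopic.Quotient x y) (q : Path.Homotopic.Quotient x z) :
    p.trans (p.symm.trans q) = q := by
  rw [← pq_assoc, pq_trans_symm, pq_refl_trans]

theorem pq_symm_symm (p : Path.Homotopic.Quotient x y) : p.symm.symm = p := by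
  rw [← pq_trans_symm_cancel p p.symm.symm, pq_trans_symm, pq_trans_refl]

theorem pq_symm_rev (p : Path.Homotopic.Quotient x y) (q : Path.Homotopic.Quotient y z) :
    (p.trans q).symm = q.symm.trans p.symm := by
  rw [← pq_symm_trans_cancel (p.trans q) (q.symm.trans p.symm), pq_assoc, pq_trans_symm_cancel,
    pq_trans_symm, pq_trans_refl]

end PathAlgebra

section ChartPath
variable {X U : Type} [TopologicalSpace X] [TopologicalSpace U] (π : U → X) (hπ : Continuous π)
  [PathConnectedSpace U] (y0 : U)

/-- The class in `X` of the image of a path from `y0` to `u`. -/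
def chartPath (u : U) (x : X) (h : π u = x) : Path.Homotopic.Quotient (π y0) x :=
  .mk (((PathConnectedSpace.somePath y0 u).map hπ).cast rfl h.symm)

/-- The class of the loop going along `chartPath` to `u` and coming back from the second point. -/
def chartLoop (u u' : U) (h : π u' = π u) : FundamentalGroup X (π y0) :=
  (chartPath π hπ y0 u (π u) rfl).trans (chartPath π hπ y0 u' (π u) h).symm

theorem chartPath_monodromy {E : Type} [TopologicalSpace E] {p : E → X} (cov : IsCoveringMap p)
    (j : U → E) (hj : Continuous j) (hpj : ∀ u, p (j u) = π u) (u : U) (x : X) (h : π u = x) :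
    cov.monodromy (chartPath π hπ y0 u x h) ⟨j y0, hpj y0⟩ = ⟨j u, (hpj u).trans h⟩ := by
  subst h
  refine cov.monodromy_eq_of_map_eq
    (.mk ((PathConnectedSpace.somePath y0 u).map hj)) ?_
  unfold chartPath
  refine congrArg Path.Homotopic.Quotient.mk (?_ : _ = (Path.cast _ _ _))
  ext t
  exact hpj _

end ChartPath

section ChartPath
variable {X U : Type} [TopologicalSpace X] [TopologicalSpace U] (π : U → X) (hπ : Continuous π)
  [SimplyConnectedSpace U] (y0 : U)

theorem chartPath_trans (u u' : U) (x x' : X) (h : π u = x)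
    (h' : π u' = x') (δ : Path u u') :
    (chartPath π hπ y0 u x h).trans (.mk ((δ.map hπ).cast h.symm h'.symm)) =
      chartPath π hπ y0 u' x' h' := by
  subst h h'
  unfold chartPath
  rw [← Path.Homotopic.Quotient.mk_trans, Path.Homotopic.Quotient.eq]
  simp only [Path.cast_rfl_rfl]
  rw [← Path.map_trans]
  exact (SimplyConnectedSpace.paths_homotopic _ _).map ⟨π, hπ⟩

theorem chartPath_base :
    chartPath π hπ y0 y0 (π y0) rfl = Path.Homotopic.Quotient.refl _ := by
  unfold chartPath
  rw [← Path.Homotopic.Quotient.mk_refl, Path.Homotopic.Quotient.eq]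
  simp only [Path.cast_rfl_rfl]
  exact (SimplyConnectedSpace.paths_homotopic _ (Path.refl y0)).map ⟨π, hπ⟩

end ChartPath

theorem monodromy_symm {X E : Type} [TopologicalSpace X] [TopologicalSpace E] {p : E → X}
    (cov : IsCoveringMap p) {x y : X} (γ : Path.Homotopic.Quotient x y) (e e')
    (h : cov.monodromy γ e = e') : cov.monodromy γ.symm e' = e := by
  rw [← h, ← cov.monodromy_trans_apply, pq_trans_symm, cov.monodromy_refl]; rfl

/-- Computation of a fundamental group from a simply connected chart `U`, glued to itself along
an involution of an open part `W`. -/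
theorem glued_bijective {X U G : Type} [TopologicalSpace X] [TopologicalSpace U] [T2Space U]
    [SimplyConnectedSpace U]
    [Group G] (π : U → X) (hπ : IsLocalHomeomorph π) (hsurj : Function.Surjective π)
    (W : Set U) (τ : U → U) (h : U → G)
    (hτW : ∀ u ∈ W, τ u ∈ W) (hττ : ∀ u ∈ W, τ (τ u) = u) (hτne : ∀ u ∈ W, τ u ≠ u)
    (hτπ : ∀ u ∈ W, π (τ u) = π u)
    (hfib : ∀ u u', π u = π u' → u = u' ∨ (u ∈ W ∧ u' = τ u))
    (hloc : ∀ u ∈ W, ∀ᶠ u' in 𝓝 u, h u' = h u)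
    (hinv : ∀ u ∈ W, h (τ u) = (h u)⁻¹)
    (hgen : Subgroup.closure (h '' W) = ⊤) (y0 : U)
    (Ψ : G →* FundamentalGroup X (π y0))
    (hΨ : ∀ u (hu : u ∈ W), Ψ (h u) = chartLoop π hπ.continuous y0 u (τ u) (hτπ u hu)) :
    Function.Bijective Ψ := by
  have hc := hπ.continuous
  constructor
  · obtain ⟨E, _, p, cov, j, hj, hpj, hW, hinj⟩ := exists_glued_cover π hπ hsurj W τ h hτW hττ hτne
      hτπ hfib hloc hinv
    have key : ∀ g a, cov.monodromyPerm (π y0) (Ψ g) ⟨j y0 a, hpj y0 a⟩ =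
        ⟨j y0 (g * a), hpj y0 (g * a)⟩ := by
      intro g
      have hg : g ∈ Subgroup.closure (h '' W) := by rw [hgen]; trivial
      induction hg using Subgroup.closure_induction with
      | mem g hg =>
        obtain ⟨u, hu, rfl⟩ := hg
        intro a
        rw [hΨ u hu]
        change cov.monodromy (chartLoop π hc y0 u (τ u) (hτπ u hu)) _ = _
        unfold chartLoop
        rw [cov.monodromy_trans_apply]
        rw [chartPath_monodromy π hc y0 cov (fun u => j u a) (hj a) (fun u => hpj u a)]
        apply monodromy_symm
        rw [chartPath_monodromy π hc y0 cov (fun u' => j u' (h u * a)) (hj _) (fun u' => hpj u' _)]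
        exact Subtype.ext (hW u hu a).symm
      | one => intro a; rw [map_one, map_one]; exact Subtype.ext (by simp)
      | mul g g' _ _ h1 h2 =>
        intro a
        rw [map_mul, map_mul, Equiv.Perm.mul_apply, h2, h1]
        simp only [mul_assoc]
      | inv g _ h1 =>
        intro a
        rw [map_inv, map_inv, Equiv.Perm.inv_eq_iff_eq, h1]
        simp
    rw [injective_iff_map_eq_one]
    intro g hg
    have := key g 1
    rw [hg, map_one] at this
    have h2 : j y0 1 = j y0 (g * 1) := congrArg Subtype.val this
    simpa using (hinj y0 h2).symm
  · have key : ∀ x x' (q : Path.Homotopic.Quotient x x'), ∀ u u' (hu : π u = x) (hu' : π u' = x'),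
        (((chartPath π hc y0 u x hu).trans q).trans (chartPath π hc y0 u' x' hu').symm :
          FundamentalGroup X (π y0)) ∈ Ψ.range := by
      have hself : ∀ x u u' (hu : π u = x) (hu' : π u' = x),
        ((chartPath π hc y0 u x hu).trans (chartPath π hc y0 u' x hu').symm :
          FundamentalGroup X (π y0)) ∈ Ψ.range := by
        rintro x u u' rfl hu'
        rcases hfib u u' hu'.symm with rfl | ⟨hW, rfl⟩
        · rw [pq_trans_symm]; exact Ψ.range.one_mem
        · exact ⟨h u, hΨ u hW⟩
      refine path_class_induction (fun x x' q => ∀ u u' (hu : π u = x) (hu' : π u' = x'),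
        (((chartPath π hc y0 u x hu).trans q).trans (chartPath π hc y0 u' x' hu').symm :
          FundamentalGroup X (π y0)) ∈ Ψ.range) ?_ ?_
      · intro x y z p q hp hq u u' hu hu'
        obtain ⟨v, hv⟩ := hsurj y
        have h1 := hp u v hu hv
        have h2 := hq v u' hv hu'
        have := Ψ.range.mul_mem h2 h1
        rw [FundamentalGroup.mul_def] at this
        simpa only [pq_assoc, pq_symm_trans_cancel] using this
      · intro x
        obtain ⟨v, hv⟩ := hsurj x
        obtain ⟨e, hve, he⟩ := hπ v
        have heπ : ∀ u, e u = π u := fun u => by rw [← he]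
        refine ⟨e.target, e.open_target, ?_, ?_⟩
        · rw [← hv, ← heπ]; exact e.map_source hve
        · intro a b γ hγ u u' hu hu'
          let δ : Path (e.symm a) (e.symm b) := γ.map' (f := e.symm)
            (e.continuousOn_symm.mono hγ)
          have ha : a ∈ e.target := hγ ⟨0, by simp⟩
          have hb : b ∈ e.target := hγ ⟨1, by simp⟩
          have ha' : π (e.symm a) = a := by rw [← heπ]; exact e.right_inv ha
          have hb' : π (e.symm b) = b := by rw [← heπ]; exact e.right_inv hb
          have h1 : ((δ.map hc).cast ha'.symm hb'.symm) = γ := by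
            ext t
            simp only [Path.cast_coe, Path.map_coe, Function.comp_apply, δ]
            rw [← heπ]
            exact e.right_inv (hγ ⟨t, rfl⟩)
          have h2 := chartPath_trans π hc y0 (e.symm a) (e.symm b) a b ha' hb' δ
          rw [h1] at h2
          have h3 := hself a u (e.symm a) hu ha'
          have h4 := hself b (e.symm b) u' hb' hu'
          have := Ψ.range.mul_mem h4 h3
          rw [FundamentalGroup.mul_def] at this
          rw [← h2] at this
          simpa only [pq_assoc, pq_symm_trans_cancel] using this
    intro γ
    have := key _ _ γ y0 y0 rfl rfl
    rw [chartPath_base, pq_refl_trans] at this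
    have h2 : (Path.Homotopic.Quotient.refl (π y0)).symm = .refl (π y0) := by
      rw [← pq_refl_trans (Path.Homotopic.Quotient.symm _), pq_trans_symm]
    rw [h2, pq_trans_refl] at this
    exact this

end PartC

section PartC2
open Set Topology unitInterval

theorem chartLoop_eq {X U : Type} [TopologicalSpace X] [TopologicalSpace U]
    [SimplyConnectedSpace U] (π : U → X) (hπ : Continuous π) (y0 : U)
    (W : Set U) (τ : U → U) (hτc : ContinuousOn τ W) (hτπ : ∀ u ∈ W, π (τ u) = π u)
    (u u' : U) (hu : u ∈ W) (hu' : u' ∈ W) (hj : JoinedIn W u u') :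
    chartLoop π hπ y0 u (τ u) (hτπ u hu) = chartLoop π hπ y0 u' (τ u') (hτπ u' hu') := by
  obtain ⟨δ, hδ⟩ := hj
  let δ' : Path (τ u) (τ u') := δ.map' (f := τ) (hτc.mono (by rintro _ ⟨t, rfl⟩; exact hδ t))
  have h1 := chartPath_trans π hπ y0 u u' _ _ rfl rfl δ
  have h2 := chartPath_trans π hπ y0 (τ u) (τ u') _ _ (hτπ u hu) (hτπ u' hu') δ'
  have h3 : (δ'.map hπ).cast (hτπ u hu).symm (hτπ u' hu').symm = (δ.map hπ).cast rfl rfl := by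
    ext t
    exact hτπ _ (hδ t)
  rw [h3] at h2
  unfold chartLoop
  rw [← h1, ← h2, pq_symm_rev, pq_assoc, pq_trans_symm_cancel]

theorem chartLoop_inv {X U : Type} [TopologicalSpace X] [TopologicalSpace U]
    [SimplyConnectedSpace U] (π : U → X) (hπ : Continuous π) (y0 : U)
    (u u' u'' : U) (h : π u' = π u) (h' : π u'' = π u') (h'' : u'' = u) :
    chartLoop π hπ y0 u' u'' h' = (chartLoop π hπ y0 u u' h)⁻¹ := by
  subst h''
  rw [FundamentalGroup.inv_def]
  unfold chartLoop
  rw [pq_symm_rev, pq_symm_symm]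
  have key : ∀ x x' : X, ∀ (h1 : π u' = x) (h2 : π u'' = x) (h3 : π u' = x') (h4 : π u'' = x'),
      (chartPath π hπ y0 u' x h1).trans (chartPath π hπ y0 u'' x h2).symm =
      (chartPath π hπ y0 u' x' h3).trans (chartPath π hπ y0 u'' x' h4).symm := by
    rintro x x' rfl h2 h3 h4
    subst h3
    rfl
  exact key _ _ _ _ _ _

/-- The homomorphism from `ℤ/2` determined by an involution. -/
def zmodTwoHom {H : Type} [Group H] (s : H) (hs : s * s = 1) : Multiplicative (ZMod 2) →* H :=
  AddMonoidHom.toMultiplicativeLeft (ZMod.lift 2 ⟨zmultiplesHom (Additive H) (Additive.ofMul s), by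
    simp only [zmultiplesHom_apply, Nat.cast_ofNat]
    rw [two_zsmul]; exact hs⟩)

theorem zmodTwoHom_apply {H : Type} [Group H] (s : H) (hs : s * s = 1) :
    zmodTwoHom s hs (Multiplicative.ofAdd 1) = s := by
  unfold zmodTwoHom
  have := ZMod.lift_coe 2 ⟨zmultiplesHom (Additive H) (Additive.ofMul s), by
    simp only [zmultiplesHom_apply, Nat.cast_ofNat]
    rw [two_zsmul]; exact hs⟩ 1
  simp only [Int.cast_one] at this
  change Additive.toMul (ZMod.lift 2 _ 1) = s
  rw [this]
  simp

/-- The group `𝔽_r * ℤ₂`. -/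
abbrev FZ (r : ℕ) : Type := Monoid.Coprod (FreeGroup (Fin r)) (Multiplicative (ZMod 2))

/-- The free generators. -/
def genF (r : ℕ) (i : Fin r) : FZ r := Monoid.Coprod.inl (FreeGroup.of i)

/-- The generator of order two. -/
def genS (r : ℕ) : FZ r := Monoid.Coprod.inr (Multiplicative.ofAdd 1)

theorem genS_inv (r : ℕ) : (genS r)⁻¹ = genS r := by
  unfold genS
  rw [← map_inv]; congr 1

theorem FZ_closure (r : ℕ) (K : Subgroup (FZ r)) (hS : genS r ∈ K) (hF : ∀ i, genF r i ∈ K) :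
    K = ⊤ := by
  rw [eq_top_iff]
  rintro g -
  induction g using Monoid.Coprod.induction_on with
  | inl m =>
    induction m using FreeGroup.induction_on with
    | C1 => rw [map_one]; exact K.one_mem
    | of i => exact hF i
    | inv_of i h => rw [map_inv]; exact K.inv_mem h
    | mul x y hx hy => rw [map_mul]; exact K.mul_mem hx hy
  | inr n =>
    have : n = 1 ∨ n = Multiplicative.ofAdd 1 := by
      revert n; decide
    rcases this with rfl | rfl
    · rw [map_one]; exact K.one_mem
    · exact hS
  | mul x y hx hy => exact K.mul_mem hx hy

/-- The final topological criterion. -/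
theorem glued_fundamentalGroup {X U : Type} (r : ℕ) [TopologicalSpace X] [TopologicalSpace U]
    [T2Space U] [SimplyConnectedSpace U]
    (π : U → X) (hπ : IsLocalHomeomorph π) (hsurj : Function.Surjective π)
    (W : Set U) (τ : U → U) (h : U → FZ r) (hτc : ContinuousOn τ W)
    (hτW : ∀ u ∈ W, τ u ∈ W) (hττ : ∀ u ∈ W, τ (τ u) = u) (hτne : ∀ u ∈ W, τ u ≠ u)
    (hτπ : ∀ u ∈ W, π (τ u) = π u)
    (hfib : ∀ u u', π u = π u' → u = u' ∨ (u ∈ W ∧ u' = τ u))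
    (hloc : ∀ u ∈ W, ∀ᶠ u' in 𝓝 u, h u' = h u)
    (hinv : ∀ u ∈ W, h (τ u) = (h u)⁻¹)
    (hval : ∀ u ∈ W, h u = genS r ∨ ∃ i, h u = genF r i ∨ h u = (genF r i)⁻¹)
    (hex0 : ∃ u ∈ W, h u = genS r) (hexi : ∀ i, ∃ u ∈ W, h u = genF r i)
    (hjoin : ∀ u ∈ W, ∀ u' ∈ W, h u = h u' → JoinedIn W u u') (x : X) :
    Nonempty (FundamentalGroup X x ≃* FZ r) := by
  have hc := hπ.continuous
  obtain ⟨y0⟩ : Nonempty U := inferInstance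
  obtain ⟨w0, hw0, hhw0⟩ := hex0
  choose w hw hhw using hexi
  have heq : ∀ u (hu : u ∈ W) u' (hu' : u' ∈ W), h u = h u' →
      chartLoop π hc y0 u (τ u) (hτπ u hu) = chartLoop π hc y0 u' (τ u') (hτπ u' hu') :=
    fun u hu u' hu' hh => chartLoop_eq π hc y0 W τ hτc hτπ u u' hu hu' (hjoin u hu u' hu' hh)
  have hli : ∀ u (hu : u ∈ W), chartLoop π hc y0 (τ u) (τ (τ u)) (hτπ _ (hτW u hu)) =
      (chartLoop π hc y0 u (τ u) (hτπ u hu))⁻¹ := fun u hu =>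
    chartLoop_inv π hc y0 _ _ _ (hτπ u hu) _ (hττ u hu)
  have hs : chartLoop π hc y0 w0 (τ w0) (hτπ w0 hw0) * chartLoop π hc y0 w0 (τ w0) (hτπ w0 hw0)
      = 1 := by
    have h1 := heq w0 hw0 (τ w0) (hτW _ hw0) (by rw [hinv _ hw0, hhw0, genS_inv])
    rw [hli w0 hw0] at h1
    nth_rewrite 1 [h1]
    exact inv_mul_cancel _
  let Ψ : FZ r →* FundamentalGroup X (π y0) := Monoid.Coprod.lift
    (FreeGroup.lift fun i => chartLoop π hc y0 (w i) (τ (w i)) (hτπ _ (hw i)))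
    (zmodTwoHom _ hs)
  have hΨS : Ψ (genS r) = chartLoop π hc y0 w0 (τ w0) (hτπ w0 hw0) := by
    simp only [Ψ, genS]
    rw [Monoid.Coprod.lift_apply_inr, zmodTwoHom_apply]
  have hΨF : ∀ i, Ψ (genF r i) = chartLoop π hc y0 (w i) (τ (w i)) (hτπ _ (hw i)) := by
    intro i
    simp only [Ψ, genF]
    rw [Monoid.Coprod.lift_apply_inl, FreeGroup.lift_apply_of]
  have hbij : Function.Bijective Ψ := by
    refine glued_bijective π hπ hsurj W τ h hτW hττ hτne hτπ hfib hloc hinv ?_ y0 Ψ ?_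
    · apply FZ_closure
      · exact Subgroup.subset_closure ⟨w0, hw0, hhw0⟩
      · exact fun i => Subgroup.subset_closure ⟨w i, hw i, hhw i⟩
    · intro u hu
      rcases hval u hu with h0 | ⟨i, h1 | h2⟩
      · rw [h0, hΨS]; exact heq _ hw0 _ hu (hhw0.trans h0.symm)
      · rw [h1, hΨF]; exact heq _ (hw i) _ hu ((hhw i).trans h1.symm)
      · rw [h2, map_inv, hΨF, ← hli _ (hw i)]
        refine heq _ (hτW _ (hw i)) _ hu ?_
        rw [hinv _ (hw i), hhw i, h2]
  have : PathConnectedSpace X := hsurj.pathConnectedSpace hc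
  exact ⟨(FundamentalGroup.fundamentalGroupMulEquivOfPathConnected x (π y0)).trans
    (MulEquiv.ofBijective Ψ hbij).symm⟩

end PartC2

section PartD
open Set Topology

/-- `t` lies in the strip to the right of `a i`. -/
def inStrip {r : ℕ} (a : Fin r → ℝ) (i : Fin r) (t : ℝ) : Prop :=
  a i < t ∧ ∀ k, a i < a k → t < a k

open Classical in
/-- The transition element attached to the strip of `t`. -/
def stripLabel {r : ℕ} (a : Fin r → ℝ) (t : ℝ) : FZ r :=
  if h : ∃ i, inStrip a i t then genF r h.choose
  else if h : ∃ i, inStrip a i (-t) then (genF r h.choose)⁻¹ else genS r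

/-- The exponent of the generator `i`. -/
def expHom (r : ℕ) (i : Fin r) : FZ r →* Multiplicative ℤ :=
  Monoid.Coprod.lift (FreeGroup.lift fun k => if k = i then Multiplicative.ofAdd 1 else 1) 1

theorem expHom_genS (r : ℕ) (i : Fin r) : expHom r i (genS r) = 1 := by
  simp [expHom, genS]

theorem expHom_genF (r : ℕ) (i k : Fin r) :
    expHom r i (genF r k) = if k = i then Multiplicative.ofAdd 1 else 1 := by
  simp [expHom, genF]

theorem genF_ne_genS (r : ℕ) (i : Fin r) : genF r i ≠ genS r := fun h => by
  have := congrArg (expHom r i) h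
  rw [expHom_genS, expHom_genF, if_pos rfl] at this
  revert this; decide

theorem genF_inv_ne_genS (r : ℕ) (i : Fin r) : (genF r i)⁻¹ ≠ genS r := fun h => by
  apply genF_ne_genS r i
  rw [← inv_inv (genF r i), h, genS_inv]

theorem genF_inj (r : ℕ) (i k : Fin r) (h : genF r k = genF r i) : k = i := by
  have := congrArg (expHom r i) h
  rw [expHom_genF, expHom_genF, if_pos rfl] at this
  by_contra hne
  rw [if_neg hne] at this
  revert this; decide

theorem genF_ne_inv (r : ℕ) (i k : Fin r) : genF r k ≠ (genF r i)⁻¹ := fun h => by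
  have := congrArg (expHom r i) h
  rw [map_inv, expHom_genF, expHom_genF, if_pos rfl] at this
  split_ifs at this <;> revert this <;> decide


theorem inStrip_unique {r : ℕ} {a : Fin r → ℝ} (ha : ∀ i, 0 < a i)
    (hinj : Function.Injective a) {i k : Fin r} {t : ℝ} (h : inStrip a i t) (h' : inStrip a k t) : i = k := by
  apply hinj
  rcases lt_trichotomy (a i) (a k) with h1 | h1 | h1
  · exact absurd (h.2 k h1) (not_lt.2 h'.1.le)
  · exact h1
  · exact absurd (h'.2 i h1) (not_lt.2 h.1.le)

theorem stripLabel_of_inStrip {r : ℕ} {a : Fin r → ℝ} (ha : ∀ i, 0 < a i)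
    (hinj : Function.Injective a) {i : Fin r} {t : ℝ} (h : inStrip a i t) :
    stripLabel a t = genF r i := by
  have hex : ∃ i, inStrip a i t := ⟨i, h⟩
  unfold stripLabel
  rw [dif_pos hex, inStrip_unique ha hinj hex.choose_spec h]

theorem stripLabel_of_inStrip_neg {r : ℕ} {a : Fin r → ℝ} (ha : ∀ i, 0 < a i)
    (hinj : Function.Injective a) {i : Fin r} {t : ℝ} (h : inStrip a i (-t)) :
    stripLabel a t = (genF r i)⁻¹ := by
  have hex : ∃ i, inStrip a i (-t) := ⟨i, h⟩
  have hn : ¬ ∃ i, inStrip a i t := by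
    rintro ⟨k, hk⟩
    have := h.1; have := hk.1; have := ha i; have := ha k
    linarith
  unfold stripLabel
  rw [dif_neg hn, dif_pos hex, inStrip_unique ha hinj hex.choose_spec h]

theorem stripLabel_of_small {r : ℕ} {a : Fin r → ℝ} (ha : ∀ i, 0 < a i)
    (hinj : Function.Injective a) {t : ℝ} (h : ∀ k, |t| < a k) : stripLabel a t = genS r := by
  unfold stripLabel
  rw [dif_neg, dif_neg]
  · rintro ⟨i, hi⟩
    have := (abs_lt.1 (h i)).1; have := hi.1; linarith
  · rintro ⟨i, hi⟩
    have := (abs_lt.1 (h i)).2; have := hi.1; linarith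

theorem strip_exists_of_lt {r : ℕ} {a : Fin r → ℝ} (ha : ∀ i, 0 < a i)
    (hinj : Function.Injective a) {t : ℝ} (ht : ∀ k, t ≠ a k) (k : Fin r) (hk : a k < t) :
    ∃ i, inStrip a i t := by
  classical
  obtain ⟨i, hi, hmax⟩ := Finset.exists_max_image (Finset.univ.filter fun i => a i < t) a
    ⟨k, by simpa using hk⟩
  simp only [Finset.mem_filter, Finset.mem_univ, true_and] at hi hmax
  refine ⟨i, hi, fun l hl => ?_⟩
  by_contra hlt
  have := hmax l (lt_of_le_of_ne (not_lt.1 hlt) (ht l).symm)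
  linarith

theorem strip_cases {r : ℕ} {a : Fin r → ℝ} (ha : ∀ i, 0 < a i)
    (hinj : Function.Injective a) {t : ℝ} (ht : ∀ k, t ≠ a k ∧ t ≠ -a k) :
    (∀ k, |t| < a k) ∨ (∃ i, inStrip a i t) ∨ (∃ i, inStrip a i (-t)) := by
  by_cases h : ∀ k, |t| < a k
  · exact Or.inl h
  · right
    push Not at h
    obtain ⟨k, hk⟩ := h
    rcases le_abs.1 hk with h1 | h1
    · left
      exact strip_exists_of_lt ha hinj (fun k => (ht k).1) k (lt_of_le_of_ne h1 (ht k).1.symm)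
    · right
      refine strip_exists_of_lt ha hinj (fun k h => (ht k).2 (by linarith)) k
        (lt_of_le_of_ne h1 (fun h => (ht k).2 (by linarith)))

theorem stripLabel_neg {r : ℕ} {a : Fin r → ℝ} (ha : ∀ i, 0 < a i)
    (hinj : Function.Injective a) {t : ℝ} (ht : ∀ k, t ≠ a k ∧ t ≠ -a k) :
    stripLabel a (-t) = (stripLabel a t)⁻¹ := by
  rcases strip_cases ha hinj ht with h | ⟨i, h⟩ | ⟨i, h⟩
  · rw [stripLabel_of_small ha hinj h, stripLabel_of_small ha hinj (by simpa using h), genS_inv]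
  · rw [stripLabel_of_inStrip ha hinj h, stripLabel_of_inStrip_neg ha hinj (by simpa using h)]
  · rw [stripLabel_of_inStrip_neg ha hinj h, stripLabel_of_inStrip ha hinj h, inv_inv]

theorem isOpen_inStrip {r : ℕ} {a : Fin r → ℝ} (ha : ∀ i, 0 < a i)
    (hinj : Function.Injective a) (i : Fin r) : IsOpen {t | inStrip a i t} := by
  have : {t | inStrip a i t} = Ioi (a i) ∩ ⋂ k, {t | a i < a k → t < a k} := by
    ext t; simp [inStrip]
  rw [this]
  refine isOpen_Ioi.inter (isOpen_iInter_of_finite fun k => ?_)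
  by_cases h : a i < a k
  · simpa [h] using! isOpen_Iio (a := a k)
  · simp [h]

theorem isOpen_small {r : ℕ} {a : Fin r → ℝ} (ha : ∀ i, 0 < a i)
    (hinj : Function.Injective a) : IsOpen {t : ℝ | ∀ k, |t| < a k} := by
  have : {t : ℝ | ∀ k, |t| < a k} = ⋂ k, {t | |t| < a k} := by ext t; simp
  rw [this]
  exact isOpen_iInter_of_finite fun k => isOpen_lt continuous_abs continuous_const

theorem ordConnected_inStrip {r : ℕ} {a : Fin r → ℝ} (ha : ∀ i, 0 < a i)
    (hinj : Function.Injective a) (i : Fin r) : OrdConnected {t | inStrip a i t} := by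
  refine ⟨fun x hx y hy z hz => ⟨lt_of_lt_of_le hx.1 hz.1, fun k hk => lt_of_le_of_lt hz.2 (hy.2 k hk)⟩⟩

theorem ordConnected_small {r : ℕ} {a : Fin r → ℝ} (ha : ∀ i, 0 < a i)
    (hinj : Function.Injective a) : OrdConnected {t : ℝ | ∀ k, |t| < a k} := by
  refine ⟨fun x hx y hy z hz k => ?_⟩
  have h1 := abs_lt.1 (hx k); have h2 := abs_lt.1 (hy k); have := hz.1; have := hz.2
  rw [abs_lt]; constructor <;> linarith

/-- All points near `t`, and on the same strip, form an open interval of constant label. -/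
theorem strip_interval {r : ℕ} {a : Fin r → ℝ} (ha : ∀ i, 0 < a i)
    (hinj : Function.Injective a) {t : ℝ} (ht : ∀ k, t ≠ a k ∧ t ≠ -a k) :
    ∃ I : Set ℝ, IsOpen I ∧ OrdConnected I ∧ t ∈ I ∧ (∀ s ∈ I, stripLabel a s = stripLabel a t) ∧
      (∀ s ∈ I, ∀ k, s ≠ a k ∧ s ≠ -a k) ∧
      (∀ s, (∀ k, s ≠ a k ∧ s ≠ -a k) → stripLabel a s = stripLabel a t → s ∈ I) := by
  rcases strip_cases ha hinj ht with h | ⟨i, h⟩ | ⟨i, h⟩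
  · refine ⟨_, isOpen_small ha hinj, ordConnected_small ha hinj, h, ?_, ?_, ?_⟩
    · intro s hs
      rw [stripLabel_of_small ha hinj h, stripLabel_of_small ha hinj hs]
    · intro s hs k
      have := abs_lt.1 (hs k)
      exact ⟨this.2.ne, this.1.ne'⟩
    · intro s hs hl
      rw [stripLabel_of_small ha hinj h] at hl
      rcases strip_cases ha hinj hs with h' | ⟨k, h'⟩ | ⟨k, h'⟩
      · exact h'
      · rw [stripLabel_of_inStrip ha hinj h'] at hl; exact absurd hl (genF_ne_genS _ _)
      · rw [stripLabel_of_inStrip_neg ha hinj h'] at hl; exact absurd hl (genF_inv_ne_genS _ _)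
  · refine ⟨_, isOpen_inStrip ha hinj i, ordConnected_inStrip ha hinj i, h, ?_, ?_, ?_⟩
    · intro s hs
      rw [stripLabel_of_inStrip ha hinj h, stripLabel_of_inStrip ha hinj hs]
    · intro s hs k
      have h1 := hs.1; have h2 := ha i; have h3 := ha k
      refine ⟨fun h => ?_, fun h => by linarith⟩
      subst h
      exact lt_irrefl _ (hs.2 k h1)
    · intro s hs hl
      rw [stripLabel_of_inStrip ha hinj h] at hl
      rcases strip_cases ha hinj hs with h' | ⟨k, h'⟩ | ⟨k, h'⟩
      · rw [stripLabel_of_small ha hinj h'] at hl; exact absurd hl.symm (genF_ne_genS _ _)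
      · rw [stripLabel_of_inStrip ha hinj h'] at hl
        rwa [genF_inj _ _ _ hl] at h'
      · rw [stripLabel_of_inStrip_neg ha hinj h'] at hl; exact absurd hl.symm (genF_ne_inv _ _ _)
  · refine ⟨(fun s => -s) ⁻¹' {t | inStrip a i t}, (isOpen_inStrip ha hinj i).preimage continuous_neg,
      ?_, h, ?_, ?_, ?_⟩
    · refine ⟨fun x hx y hy z hz => (ordConnected_inStrip ha hinj i).out hy hx
        ⟨neg_le_neg hz.2, neg_le_neg hz.1⟩⟩
    · intro s hs
      rw [stripLabel_of_inStrip_neg ha hinj h, stripLabel_of_inStrip_neg ha hinj hs]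
    · intro s hs k
      have h1 := hs.1; have h2 := ha i; have h3 := ha k
      refine ⟨fun h => by linarith, fun h => ?_⟩
      subst h
      simp only [neg_neg] at h1
      have := hs.2 k h1
      simp at this
    · intro s hs hl
      rw [stripLabel_of_inStrip_neg ha hinj h] at hl
      rcases strip_cases ha hinj hs with h' | ⟨k, h'⟩ | ⟨k, h'⟩
      · rw [stripLabel_of_small ha hinj h'] at hl; exact absurd hl.symm (genF_inv_ne_genS _ _)
      · rw [stripLabel_of_inStrip ha hinj h'] at hl; exact absurd hl (genF_ne_inv _ _ _)
      · rw [stripLabel_of_inStrip_neg ha hinj h'] at hl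
        rw [genF_inj _ _ _ (inv_injective hl)] at h'
        exact h'

theorem exists_small {r : ℕ} {a : Fin r → ℝ} (ha : ∀ i, 0 < a i)
    (hinj : Function.Injective a) : ∃ t : ℝ, 0 < t ∧ (∀ k, |t| < a k) := by
  have : ∀ᶠ t in 𝓝 (0:ℝ), ∀ k, |t| < a k :=
    (isOpen_small ha hinj).mem_nhds (by simpa using ha)
  have h2 : ∀ᶠ t in 𝓝[>] (0:ℝ), (∀ k, |t| < a k) ∧ t ∈ Ioi 0 :=
    (this.filter_mono nhdsWithin_le_nhds).and self_mem_nhdsWithin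
  obtain ⟨t, h3, h4⟩ := h2.exists
  exact ⟨t, h4, h3⟩

theorem exists_inStrip {r : ℕ} {a : Fin r → ℝ} (ha : ∀ i, 0 < a i)
    (hinj : Function.Injective a) (i : Fin r) : ∃ t : ℝ, 0 < t ∧ inStrip a i t := by
  have : ∀ᶠ t in 𝓝 (a i), ∀ k, a i < a k → t < a k := by
    rw [Filter.eventually_all]
    intro k
    by_cases h : a i < a k
    · filter_upwards [isOpen_Iio.mem_nhds h] with t ht _ using ht
    · simp [h]
  have h2 : ∀ᶠ t in 𝓝[>] (a i), (∀ k, a i < a k → t < a k) ∧ t ∈ Ioi (a i) :=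
    (this.filter_mono nhdsWithin_le_nhds).and self_mem_nhdsWithin
  obtain ⟨t, h3, h4⟩ := h2.exists
  exact ⟨t, (ha i).trans h4, h4, h3⟩

end PartD

section PartE1
open Set Topology

/-- The plane slit along upward vertical half-lines starting at the points `± p i`. -/
def slitPlane {r : ℕ} (p : Fin r → ℂ) : Set ℂ :=
  {z | ∀ i, (z.re = (p i).re → z.im < (p i).im) ∧ (z.re = -(p i).re → z.im < -(p i).im)}

theorem isOpen_slitPlane {r : ℕ} (p : Fin r → ℂ) : IsOpen (slitPlane p) := by
  have : slitPlane p = ⋂ i, (({z : ℂ | z.re ≠ (p i).re} ∪ {z : ℂ | z.im < (p i).im}) ∩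
      ({z : ℂ | z.re ≠ -(p i).re} ∪ {z : ℂ | z.im < -(p i).im})) := by
    ext z
    simp only [slitPlane, mem_setOf_eq, mem_iInter, mem_inter_iff, mem_union]
    refine forall_congr' fun i => ?_
    rw [imp_iff_not_or, imp_iff_not_or]
  rw [this]
  refine isOpen_iInter_of_finite fun i => IsOpen.inter (IsOpen.union ?_ ?_) (IsOpen.union ?_ ?_)
  · exact isOpen_ne_fun Complex.continuous_re continuous_const
  · exact isOpen_lt Complex.continuous_im continuous_const
  · exact isOpen_ne_fun Complex.continuous_re continuous_const
  · exact isOpen_lt Complex.continuous_im continuous_const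

theorem slitPlane_inter_neg {r : ℕ} (p : Fin r → ℂ) (z : ℂ) :
    (z ∈ slitPlane p ∧ -z ∈ slitPlane p) ↔ ∀ i, z.re ≠ (p i).re ∧ z.re ≠ -(p i).re := by
  constructor
  · rintro ⟨h1, h2⟩ i
    obtain ⟨h3, h4⟩ := h1 i
    obtain ⟨h5, h6⟩ := h2 i
    simp only [Complex.neg_re, Complex.neg_im] at h5 h6
    constructor
    · intro h
      have := h3 h; have := h6 (by linarith); linarith
    · intro h
      have := h4 h; have := h5 (by linarith); linarith
  · intro h
    refine ⟨fun i => ⟨fun h1 => absurd h1 (h i).1, fun h1 => absurd h1 (h i).2⟩,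
      fun i => ⟨fun h1 => ?_, fun h1 => ?_⟩⟩
    · simp only [Complex.neg_re] at h1
      exact absurd (by linarith) (h i).2
    · simp only [Complex.neg_re] at h1
      exact absurd (by linarith) (h i).1

theorem slitPlane_or_neg {r : ℕ} (p : Fin r → ℂ) (hp : ∀ i, 0 < (p i).re)
    (hinj : Function.Injective fun i => (p i).re) (z : ℂ) (h : ∀ i, z ≠ p i ∧ z ≠ -p i) :
    z ∈ slitPlane p ∨ -z ∈ slitPlane p := by
  by_contra hcon
  push Not at hcon
  obtain ⟨h1, h2⟩ := hcon
  simp only [slitPlane, mem_setOf_eq, not_forall, not_and_or, not_lt] at h1 h2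
  obtain ⟨i, h1⟩ := h1
  obtain ⟨k, h2⟩ := h2
  have hi := hp i
  have hk := hp k
  simp only [Complex.neg_re, Complex.neg_im] at h2
  rcases h1 with ⟨h1, h1'⟩ | ⟨h1, h1'⟩ <;> rcases h2 with ⟨h2, h2'⟩ | ⟨h2, h2'⟩
  · linarith
  · have : i = k := hinj (by simp only; linarith)
    subst this
    exact (h i).1 (Complex.ext h1 (by linarith))
  · have : i = k := hinj (by simp only; linarith)
    subst this
    exact (h i).2 (Complex.ext (by simpa using h1) (by simp; linarith))
  · linarith

theorem slitPlane_ne {r : ℕ} (p : Fin r → ℂ) (z : ℂ) (h : z ∈ slitPlane p) (i) :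
    z ≠ p i ∧ z ≠ -p i := by
  constructor
  · rintro rfl
    exact lt_irrefl _ ((h i).1 rfl)
  · rintro rfl
    exact lt_irrefl _ ((h i).2 rfl)

/-- Real inequality behind the contraction of a slit plane. -/
theorem slit_ineq (D Y : ℝ) (hD : D ≠ 0) : ∃ K0 : ℝ, 0 < K0 ∧ ∀ K ≥ K0, ∀ x y σ : ℝ, 0 ≤ σ → σ ≤ 1 →
    σ * x = D → σ * (y - K * (x ^ 2 + y ^ 2)) < Y := by
  refine ⟨1 + 2 * (|Y| + 1) / D ^ 2 + 1 / |D|, by positivity, ?_⟩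
  intro K hK x y σ h0 h1 hx
  have hD2 : 0 < D ^ 2 := by positivity
  have hDa : 0 < |D| := abs_pos.2 hD
  have e1 : (0:ℝ) ≤ 2 * (|Y| + 1) / D ^ 2 := by positivity
  have e2 : (0:ℝ) ≤ 1 / |D| := by positivity
  have hK1 : 1 ≤ K := by linarith
  have hK2 : 2 * (|Y| + 1) ≤ K * D ^ 2 := by
    have : 2 * (|Y| + 1) / D ^ 2 ≤ K := by linarith
    rwa [div_le_iff₀ hD2] at this
  have hK3 : 1 ≤ K * |D| := by
    have : 1 / |D| ≤ K := by linarith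
    rwa [div_le_iff₀ hDa] at this
  have hσ : 0 < σ := lt_of_le_of_ne h0 (fun h => hD (by rw [← hx, ← h, zero_mul]))
  -- `x² ≥ D²`, `σ x² ≥ D²`
  have hσx : D ^ 2 ≤ σ * x ^ 2 := by
    rw [← hx]; nlinarith [mul_nonneg h0 (sq_nonneg x), mul_nonneg (mul_nonneg h0 (sq_nonneg x)) (sub_nonneg.2 h1)]
  have hY : -|Y| ≤ Y := neg_abs_le Y
  have hKK : 1 ≤ K ^ 2 * D ^ 2 := by
    rw [← sq_abs D]; nlinarith
  -- `y ≤ K y² + 1 / (4 K)`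
  have h3 : y - K * y ^ 2 ≤ 1 / (4 * K) := by
    rw [le_div_iff₀ (by positivity)]
    nlinarith [sq_nonneg (2 * K * y - 1)]
  have h4 : 1 / (4 * K) ≤ K * D ^ 2 / 4 := by
    rw [div_le_iff₀ (by positivity)]
    nlinarith
  have h5 : σ * (y - K * y ^ 2) ≤ K * D ^ 2 / 4 := by
    have h6 : σ * (y - K * y ^ 2) ≤ σ * (K * D ^ 2 / 4) := by
      apply mul_le_mul_of_nonneg_left (by linarith) h0
    have h7 : 0 ≤ K * D ^ 2 / 4 := by positivity
    nlinarith
  have h8 : K * D ^ 2 ≤ K * (σ * x ^ 2) := mul_le_mul_of_nonneg_left hσx (by linarith)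
  have h9 : 0 ≤ |Y| := abs_nonneg Y
  nlinarith

theorem slitPlane_contract {r : ℕ} (p : Fin r → ℂ) (c : ℂ)
    (hc : ∀ i, c.re ≠ (p i).re ∧ c.re ≠ -(p i).re) :
    ∃ K : ℝ, (∀ w : ℂ, c + w ∈ slitPlane p → ∀ s : ℝ, 0 ≤ s → s ≤ 1 →
        c + w * (1 - Complex.I * (s * K : ℝ) * (starRingEnd ℂ) w) ∈ slitPlane p) ∧
      (∀ w : ℂ, ∀ s : ℝ, 0 ≤ s → s ≤ 1 →
        c + s * (w * (1 - Complex.I * (K : ℝ) * (starRingEnd ℂ) w)) ∈ slitPlane p) := by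
  have h1 : ∀ i, ∃ K0 : ℝ, 0 < K0 ∧ ∀ K ≥ K0, ∀ x y σ : ℝ, 0 ≤ σ → σ ≤ 1 →
    σ * x = (p i).re - c.re → σ * (y - K * (x ^ 2 + y ^ 2)) < (p i).im - c.im := fun i =>
    slit_ineq _ _ (sub_ne_zero.2 (hc i).1.symm)
  have h2 : ∀ i, ∃ K0 : ℝ, 0 < K0 ∧ ∀ K ≥ K0, ∀ x y σ : ℝ, 0 ≤ σ → σ ≤ 1 →
    σ * x = -(p i).re - c.re → σ * (y - K * (x ^ 2 + y ^ 2)) < -(p i).im - c.im := fun i =>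
    slit_ineq _ _ (sub_ne_zero.2 (hc i).2.symm)
  choose K1 hK1 h1 using h1
  choose K2 hK2 h2 using h2
  have hle1 : ∀ i, K1 i ≤ ∑ j, (K1 j + K2 j) := fun i =>
    (le_add_of_nonneg_right (hK2 i).le).trans
      (Finset.single_le_sum (f := fun j => K1 j + K2 j) (fun j _ => (add_pos (hK1 j) (hK2 j)).le)
        (Finset.mem_univ i))
  have hle2 : ∀ i, K2 i ≤ ∑ j, (K1 j + K2 j) := fun i =>
    (le_add_of_nonneg_left (hK1 i).le).trans
      (Finset.single_le_sum (f := fun j => K1 j + K2 j) (fun j _ => (add_pos (hK1 j) (hK2 j)).le)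
        (Finset.mem_univ i))
  have hK0 : 0 ≤ ∑ j, (K1 j + K2 j) :=
    Finset.sum_nonneg fun j _ => (add_pos (hK1 j) (hK2 j)).le
  generalize ∑ j, (K1 j + K2 j) = K at *
  have hform : ∀ w : ℂ, ∀ t : ℝ, w * (1 - Complex.I * (t : ℝ) * (starRingEnd ℂ) w) =
      ⟨w.re, w.im - t * (w.re ^ 2 + w.im ^ 2)⟩ := by
    intro w t
    apply Complex.ext <;> simp <;> ring
  refine ⟨K, ?_, ?_⟩
  · intro w hw s hs0 hs1 i
    rw [hform]
    have h3 := hw i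
    simp only [Complex.add_re, Complex.add_im] at h3 ⊢
    have : 0 ≤ s * K * (w.re ^ 2 + w.im ^ 2) := by positivity
    exact ⟨fun h => by linarith [h3.1 h], fun h => by linarith [h3.2 h]⟩
  · intro w s hs0 hs1 i
    rw [hform]
    simp only [Complex.add_re, Complex.add_im, Complex.re_ofReal_mul, Complex.im_ofReal_mul]
    exact ⟨fun h => by linarith [h1 i K (hle1 i) w.re w.im s hs0 hs1 (by linarith)],
      fun h => by linarith [h2 i K (hle2 i) w.re w.im s hs0 hs1 (by linarith)]⟩

end PartE1

section PartE2
open Set Topology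

theorem contractible_of_three (U : Set (ℂ × ℂ)) (F G H : ℝ × (ℂ × ℂ) → ℂ × ℂ) (c : ℂ × ℂ)
    (hF : Continuous F) (hG : Continuous G) (hH : Continuous H)
    (hFU : ∀ s : ℝ, 0 ≤ s → s ≤ 1 → ∀ u ∈ U, F (s, u) ∈ U)
    (hGU : ∀ s : ℝ, 0 ≤ s → s ≤ 1 → ∀ u ∈ U, G (s, u) ∈ U)
    (hHU : ∀ s : ℝ, 0 ≤ s → s ≤ 1 → ∀ u ∈ U, H (s, u) ∈ U)
    (h0 : ∀ u, F (0, u) = u) (h1 : ∀ u, F (1, u) = G (0, u)) (h2 : ∀ u, G (1, u) = H (0, u))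
    (h3 : ∀ u, H (1, u) = c) (hc : c ∈ U) : ContractibleSpace U := by
  have key : ∀ F : ℝ × (ℂ × ℂ) → ℂ × ℂ, ∀ hF : Continuous F,
      (∀ s : ℝ, 0 ≤ s → s ≤ 1 → ∀ u ∈ U, F (s, u) ∈ U) → ∀ f g : C(U, U),
      (∀ u : U, (f u : ℂ × ℂ) = F (0, u)) → (∀ u : U, (g u : ℂ × ℂ) = F (1, u)) →
      ContinuousMap.Homotopic f g := by
    intro F hF hFU f g hf hg
    refine ⟨{ toFun := fun q => ⟨F (q.1, q.2), hFU _ q.1.2.1 q.1.2.2 _ q.2.2⟩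
              continuous_toFun := ?_
              map_zero_left := ?_
              map_one_left := ?_ }⟩
    · refine Continuous.subtype_mk (hF.comp ?_) _
      fun_prop
    · intro u; exact Subtype.ext (hf u).symm
    · intro u; exact Subtype.ext (hg u).symm
  let mk : ∀ F : ℝ × (ℂ × ℂ) → ℂ × ℂ, ∀ hF : Continuous F,
      (∀ s : ℝ, 0 ≤ s → s ≤ 1 → ∀ u ∈ U, F (s, u) ∈ U) → C(U, U) := fun F hF hFU =>
    ⟨fun u => ⟨F (1, u), hFU 1 zero_le_one le_rfl u u.2⟩,
      Continuous.subtype_mk (hF.comp (by fun_prop)) _⟩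
  rw [contractible_iff_id_nullhomotopic]
  refine ⟨⟨c, hc⟩, ?_⟩
  refine (key F hF hFU (ContinuousMap.id U) (mk F hF hFU) (fun u => (h0 u).symm) (fun u => rfl)).trans
    ((key G hG hGU (mk F hF hFU) (mk G hG hGU) (fun u => h1 u) (fun u => rfl)).trans
      (key H hH hHU (mk G hG hGU) (ContinuousMap.const _ _) (fun u => h2 u) (fun u => (h3 u).symm)))

theorem contractible_transversal {r : ℕ} (p : Fin r → ℂ) (l : ℂ)
    (hl : ∀ i, l.re ≠ (p i).re ∧ l.re ≠ -(p i).re) :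
    ContractibleSpace {u : ℂ × ℂ | l * (1 - u.1 * u.2) ∈ slitPlane p} := by
  obtain ⟨K, hK1, hK2⟩ := slitPlane_contract p l hl
  refine contractible_of_three _
    (fun q => (q.2.1, q.2.2 * (1 - Complex.I * (q.1 * K : ℝ) * (starRingEnd ℂ) (-(l * q.2.1 * q.2.2)))))
    (fun q => (q.2.1, ((1 - q.1 : ℝ) : ℂ) * (q.2.2 * (1 - Complex.I * (K : ℝ) * (starRingEnd ℂ) (-(l * q.2.1 * q.2.2))))))
    (fun q => (((1 - q.1 : ℝ) : ℂ) * q.2.1, 0)) (0, 0) (by fun_prop) (by fun_prop) (by fun_prop)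
    ?_ ?_ ?_ ?_ ?_ ?_ ?_ ?_
  · intro s hs0 hs1 u hu
    have := hK1 (-(l * u.1 * u.2)) (by have hu' : l * (1 - u.1 * u.2) ∈ slitPlane p := hu; convert hu' using 1; ring) s hs0 hs1
    change l * (1 - u.1 * (u.2 * _)) ∈ slitPlane p
    convert this using 1; ring
  · intro s hs0 hs1 u hu
    have := hK2 (-(l * u.1 * u.2)) (1 - s) (by linarith) (by linarith)
    change l * (1 - u.1 * (_ * (u.2 * _))) ∈ slitPlane p
    convert this using 1; ring
  · intro s hs0 hs1 u hu
    have := hK2 0 0 le_rfl zero_le_one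
    change l * (1 - _ * 0) ∈ slitPlane p
    convert this using 1; simp
  · intro u; simp
  · intro u; simp
  · intro u; simp
  · intro u; simp
  · have := hK2 0 0 le_rfl zero_le_one
    change l * (1 - 0 * 0) ∈ slitPlane p
    convert this using 1; simp

theorem contractible_tangent {r : ℕ} (p : Fin r → ℂ) (l : ℂ) (hp : ∀ i, 0 < (p i).re) :
    ContractibleSpace {u : ℂ × ℂ | l * u.1 ∈ slitPlane p} := by
  obtain ⟨K, hK1, hK2⟩ := slitPlane_contract p 0 (fun i => by
    have := hp i
    simp only [Complex.zero_re]
    exact ⟨by linarith, by linarith⟩)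
  refine contractible_of_three _
    (fun q => (q.2.1 * (1 - Complex.I * (q.1 * K : ℝ) * (starRingEnd ℂ) (l * q.2.1)), q.2.2))
    (fun q => (((1 - q.1 : ℝ) : ℂ) * (q.2.1 * (1 - Complex.I * (K : ℝ) * (starRingEnd ℂ) (l * q.2.1))), q.2.2))
    (fun q => (0, ((1 - q.1 : ℝ) : ℂ) * q.2.2)) (0, 0) (by fun_prop) (by fun_prop) (by fun_prop)
    ?_ ?_ ?_ ?_ ?_ ?_ ?_ ?_
  · intro s hs0 hs1 u hu
    have := hK1 (l * u.1) (by have hu' : l * u.1 ∈ slitPlane p := hu; convert hu' using 1; simp) s hs0 hs1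
    change l * (u.1 * _) ∈ slitPlane p
    convert this using 1; ring
  · intro s hs0 hs1 u hu
    have := hK2 (l * u.1) (1 - s) (by linarith) (by linarith)
    change l * (_ * (u.1 * _)) ∈ slitPlane p
    convert this using 1; ring
  · intro s hs0 hs1 u hu
    have := hK2 0 0 le_rfl zero_le_one
    change l * 0 ∈ slitPlane p
    convert this using 1; simp
  · intro u; simp
  · intro u; simp
  · intro u; simp
  · intro u; simp
  · have := hK2 0 0 le_rfl zero_le_one
    change l * 0 ∈ slitPlane p
    convert this using 1; simp

theorem joined_transversal (l : ℂ) (hl : l ≠ 0) (D : Set ℂ) (hD : Convex ℝ D) (u u' : ℂ × ℂ)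
    (hu : u.1 ≠ 0) (hu' : u'.1 ≠ 0) (hD1 : l * (1 - u.1 * u.2) ∈ D)
    (hD2 : l * (1 - u'.1 * u'.2) ∈ D) :
    JoinedIn {u : ℂ × ℂ | u.1 ≠ 0 ∧ l * (1 - u.1 * u.2) ∈ D} u u' := by
  have h1 : IsPathConnected ({0}ᶜ : Set ℂ) := by
    apply isPathConnected_compl_singleton_of_one_lt_rank
    rw [Complex.rank_real_complex]; norm_num
  have h2 : IsPathConnected D := hD.isPathConnected ⟨_, hD1⟩
  have h3 := (h1.prod h2).image' (f := fun q : ℂ × ℂ => (q.1, (1 - q.2 / l) / q.1)) (by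
    intro q hq
    have : q.1 ≠ 0 := hq.1
    apply ContinuousAt.continuousWithinAt
    fun_prop (disch := assumption))
  have hm : ∀ u : ℂ × ℂ, u.1 ≠ 0 → l * (1 - u.1 * u.2) ∈ D →
      u ∈ (fun q : ℂ × ℂ => (q.1, (1 - q.2 / l) / q.1)) '' ({0}ᶜ ×ˢ D) := by
    intro u hu hd
    refine ⟨(u.1, l * (1 - u.1 * u.2)), ⟨hu, hd⟩, ?_⟩
    ext
    · rfl
    · simp only; field_simp; ring
  refine (h3.joinedIn u (hm u hu hD1) u' (hm u' hu' hD2)).mono ?_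
  rintro _ ⟨q, ⟨h4, h5⟩, rfl⟩
  have h4' : q.1 ≠ 0 := h4
  refine ⟨h4, ?_⟩
  convert h5 using 1
  simp only; field_simp; ring

theorem convex_diff_zero (D : Set ℂ) (hD : Convex ℝ D) (hDo : IsOpen D) (hne : (D \ {0}).Nonempty) :
    IsPathConnected (D \ {0}) := by
  by_cases h0 : (0 : ℂ) ∈ D
  · obtain ⟨ε, hε, hball⟩ := Metric.isOpen_iff.1 hDo 0 h0
    have hsph : IsPathConnected (Metric.sphere (0 : ℂ) (ε / 2)) := by
      apply isPathConnected_sphere _ _ (by positivity)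
      rw [Complex.rank_real_complex]; norm_num
    have hsub : Metric.sphere (0 : ℂ) (ε / 2) ⊆ D \ {0} := by
      intro z hz
      rw [mem_sphere_zero_iff_norm] at hz
      refine ⟨hball ?_, ?_⟩
      · rw [mem_ball_zero_iff, hz]; linarith
      · rintro rfl
        rw [norm_zero] at hz; linarith
    have hjoin : ∀ z ∈ D \ {0}, ∃ w ∈ Metric.sphere (0 : ℂ) (ε / 2), JoinedIn (D \ {0}) z w := by
      rintro z ⟨hz, hz0⟩
      have hz0' : z ≠ 0 := hz0
      have hn : 0 < ‖z‖ := norm_pos_iff.2 hz0'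
      have hw : ((ε / 2 / ‖z‖ : ℝ) : ℂ) * z ∈ Metric.sphere (0 : ℂ) (ε / 2) := by
        rw [mem_sphere_zero_iff_norm, norm_mul, Complex.norm_real, Real.norm_of_nonneg (by positivity)]
        field_simp
      refine ⟨_, hw, JoinedIn.of_segment_subset ?_⟩
      intro y hy
      refine ⟨hD.segment_subset hz (hsub hw).1 hy, ?_⟩
      obtain ⟨a, b, ha, hb, hab, rfl⟩ := hy
      have : a • z + b • (((ε / 2 / ‖z‖ : ℝ) : ℂ) * z) = ((a + b * (ε / 2 / ‖z‖) : ℝ) : ℂ) * z := by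
        simp only [Complex.real_smul]; push_cast; ring
      rw [this]
      have hpos : 0 < a + b * (ε / 2 / ‖z‖) := by
        rcases eq_or_lt_of_le ha with h | h
        · have : 0 < b := by linarith
          rw [← h]; positivity
        · positivity
      simp only [mem_singleton_iff, mul_eq_zero, not_or]
      exact ⟨by exact_mod_cast hpos.ne', hz0'⟩
    rw [isPathConnected_iff]
    refine ⟨hne, fun x hx y hy => ?_⟩
    obtain ⟨w, hw, h1⟩ := hjoin x hx
    obtain ⟨w', hw', h2⟩ := hjoin y hy
    exact (h1.trans ((hsph.joinedIn w hw w' hw').mono hsub)).trans h2.symm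
  · rw [diff_singleton_eq_self h0] at hne ⊢
    exact hD.isPathConnected hne

theorem joined_tangent (l : ℂ) (hl : l ≠ 0) (D : Set ℂ) (hD : Convex ℝ D) (hDo : IsOpen D) (u u' : ℂ × ℂ)
    (hu : u.1 ≠ 0) (hu' : u'.1 ≠ 0) (hD1 : l * u.1 ∈ D)
    (hD2 : l * u'.1 ∈ D) :
    JoinedIn {u : ℂ × ℂ | u.1 ≠ 0 ∧ l * u.1 ∈ D} u u' := by
  have h1 : IsPathConnected (D \ {0}) := convex_diff_zero D hD hDo ⟨_, hD1, by simp [hl, hu]⟩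
  have h3 := (h1.prod (isPathConnected_univ (X := ℂ))).image' (f := fun q : ℂ × ℂ => (q.1 / l, q.2))
    (by fun_prop)
  have hm : ∀ u : ℂ × ℂ, u.1 ≠ 0 → l * u.1 ∈ D →
      u ∈ (fun q : ℂ × ℂ => (q.1 / l, q.2)) '' ((D \ {0}) ×ˢ univ) := by
    intro u hu hd
    refine ⟨(l * u.1, u.2), ⟨⟨hd, by simp [hl, hu]⟩, trivial⟩, ?_⟩
    ext
    · simp only; field_simp
    · rfl
  refine (h3.joinedIn u (hm u hu hD1) u' (hm u' hu' hD2)).mono ?_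
  rintro _ ⟨q, ⟨⟨h4, h5⟩, -⟩, rfl⟩
  have h5' : q.1 ≠ 0 := h5
  refine ⟨by simp [h5', hl], ?_⟩
  convert h4 using 1
  simp only; field_simp

end PartE2

section PartE3
open Set Topology

/-- Affine chart of the quadric `xy + z² = 1`. -/
def phi (u : ℂ × ℂ) : Fin 3 → ℂ := ![u.1, u.2 * (2 - u.1 * u.2), 1 - u.1 * u.2]

/-- The model quadratic form. -/
def q0 (w : Fin 3 → ℂ) : ℂ := w 0 * w 1 + w 2 ^ 2

/-- The involution `v ↦ -v` of the quadric, in the chart. -/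
def tau (u : ℂ × ℂ) : ℂ × ℂ := (-u.1, u.2 - 2 / u.1)

theorem q0_phi (u : ℂ × ℂ) : q0 (phi u) = 1 := by
  simp [q0, phi]; ring

theorem q0_smul (t : ℂ) (w : Fin 3 → ℂ) : q0 (t • w) = t ^ 2 * q0 w := by
  simp [q0]; ring

theorem continuous_q0 : Continuous q0 := by unfold q0; fun_prop

theorem continuous_phi : Continuous phi := by
  refine continuous_pi fun i => ?_
  fin_cases i <;> simp [phi] <;> fun_prop

theorem phi_ne (u : ℂ × ℂ) : phi u ≠ 0 := fun h => by
  have := q0_phi u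
  rw [h] at this; simp [q0] at this

theorem phi_inj {u u' : ℂ × ℂ} (h : phi u = phi u') : u = u' := by
  have h0 := congrFun h 0
  have h1 := congrFun h 1
  have h2 := congrFun h 2
  simp [phi] at h0 h1 h2
  obtain ⟨x, m⟩ := u
  obtain ⟨x', m'⟩ := u'
  simp only at h0 h1 h2
  subst h0
  by_cases hx : x = 0
  · subst hx
    have : m = m' := by
      have h3 : m * 2 = m' * 2 := by simpa using h1
      exact mul_right_cancel₀ two_ne_zero h3
    rw [this]
  · have h3 : x * m = x * m' := by
      first
        | exact h2
        | (rcases h2 with h2 | h2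
           · rw [h2]
           · exact absurd h2 hx)
    rw [mul_left_cancel₀ hx h3]

theorem phi_tau {u : ℂ × ℂ} (h : u.1 ≠ 0) : phi (tau u) = -phi u := by
  ext i
  fin_cases i <;> simp [phi, tau] <;> field_simp <;> ring

theorem phi_neg {u u' : ℂ × ℂ} (h : phi u' = -phi u) : u.1 ≠ 0 ∧ u' = tau u := by
  have h0 := congrFun h 0
  have h2 := congrFun h 2
  simp [phi] at h0 h2
  have hu : u.1 ≠ 0 := by
    intro hu
    rw [h0, hu] at h2
    norm_num at h2
  exact ⟨hu, phi_inj (by rw [h, phi_tau hu])⟩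

theorem tau_tau {u : ℂ × ℂ} (h : u.1 ≠ 0) : tau (tau u) = u := by
  ext
  · simp [tau]
  · simp [tau]; field_simp; ring

theorem phi_chart1 (w : Fin 3 → ℂ) (hq : q0 w = 1) (h : w 0 ≠ 0) :
    phi (w 0, (1 - w 2) / w 0) = w := by
  unfold q0 at hq
  ext i
  fin_cases i
  · simp [phi]
  · simp [phi]; field_simp; linear_combination -hq
  · simp [phi]; field_simp; ring

theorem phi_chart2 (w : Fin 3 → ℂ) (hq : q0 w = 1) (h : 1 + w 2 ≠ 0) :
    phi (w 0, w 1 / (1 + w 2)) = w := by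
  unfold q0 at hq
  ext i
  fin_cases i
  · simp [phi]
  · simp [phi]; field_simp; linear_combination -(w 1) * hq
  · simp [phi]; field_simp; linear_combination -hq

theorem phi_open (u0 : ℂ × ℂ) (O : Set (ℂ × ℂ)) (hO : O ∈ 𝓝 u0) :
    ∀ᶠ w in 𝓝 (phi u0), ∃ u ∈ O, ∃ t : ℂ, t ≠ 0 ∧ w = t • phi u := by
  let s : (Fin 3 → ℂ) → ℂ := fun w => (q0 w) ^ (1 / 2 : ℂ)
  have hs2 : ∀ w, s w ^ 2 = q0 w := fun w => by
    simp only [s]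
    rw [← Complex.cpow_nat_mul]
    norm_num
  have hs1 : s (phi u0) = 1 := by simp only [s]; rw [q0_phi, Complex.one_cpow]
  have hsc : ContinuousAt s (phi u0) := by
    refine ContinuousAt.cpow (f := q0) continuous_q0.continuousAt continuousAt_const ?_
    rw [q0_phi]; exact Complex.one_mem_slitPlane
  have hs0 : ∀ᶠ w in 𝓝 (phi u0), s w ≠ 0 := hsc.eventually_ne (by rw [hs1]; exact one_ne_zero)
  let n : (Fin 3 → ℂ) → (Fin 3 → ℂ) := fun w => (s w)⁻¹ • w
  have hn1 : n (phi u0) = phi u0 := by simp only [n]; rw [hs1]; simp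
  have hnc : ContinuousAt n (phi u0) :=
    (hsc.inv₀ (by rw [hs1]; exact one_ne_zero)).smul continuousAt_id
  have hnq : ∀ w, s w ≠ 0 → q0 (n w) = 1 := fun w hw => by
    simp only [n]; rw [q0_smul, ← hs2 w]; field_simp
  have hnw : ∀ w, s w ≠ 0 → w = s w • n w := fun w hw => by
    simp only [n]; rw [smul_smul, mul_inv_cancel₀ hw, one_smul]
  -- a local inverse of the chart
  have key : ∃ ψ : (Fin 3 → ℂ) → ℂ × ℂ, ContinuousAt ψ (phi u0) ∧ ψ (phi u0) = u0 ∧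
      ∀ᶠ w in 𝓝 (phi u0), q0 w = 1 → phi (ψ w) = w := by
    have hc : ∀ i : Fin 3, ContinuousAt (fun w : Fin 3 → ℂ => w i) (phi u0) :=
      fun i => (continuous_apply i).continuousAt
    by_cases hx : u0.1 = 0
    · have h2 : 1 + phi u0 2 ≠ 0 := by simp [phi, hx]
      refine ⟨fun w => (w 0, w 1 / (1 + w 2)), ?_, ?_, ?_⟩
      · exact (hc 0).prodMk ((hc 1).div (continuousAt_const.add (hc 2)) h2)
      · exact phi_inj (phi_chart2 _ (q0_phi u0) h2)
      · filter_upwards [(continuousAt_const.add (hc 2)).eventually_ne h2] with w hw hq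
        exact phi_chart2 w hq hw
    · have h2 : phi u0 0 ≠ 0 := by simpa [phi] using hx
      refine ⟨fun w => (w 0, (1 - w 2) / w 0), ?_, ?_, ?_⟩
      · exact (hc 0).prodMk ((continuousAt_const.sub (hc 2)).div (hc 0) h2)
      · exact phi_inj (phi_chart1 _ (q0_phi u0) h2)
      · filter_upwards [(hc 0).eventually_ne h2] with w hw hq
        exact phi_chart1 w hq hw
  obtain ⟨ψ, hψc, hψ0, hψ⟩ := key
  have hnt : Filter.Tendsto n (𝓝 (phi u0)) (𝓝 (phi u0)) := by
    have := hnc.tendsto; rwa [hn1] at this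
  have hψt : Filter.Tendsto ψ (𝓝 (phi u0)) (𝓝 u0) := by
    have := hψc.tendsto; rwa [hψ0] at this
  filter_upwards [hs0, hnt.eventually hψ, (hψt.comp hnt) hO] with w h1 h2 h3
  refine ⟨ψ (n w), h3, s w, h1, ?_⟩
  rw [h2 (hnq w h1)]
  exact hnw w h1

theorem phi_open_T (T : (Fin 3 → ℂ) ≃ₗ[ℂ] (Fin 3 → ℂ)) (u0 : ℂ × ℂ) (O : Set (ℂ × ℂ))
    (hO : O ∈ 𝓝 u0) (t0 : ℂ) (ht0 : t0 ≠ 0) :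
    ∀ᶠ v in 𝓝 (t0 • T (phi u0)), ∃ u ∈ O, ∃ t : ℂ, t ≠ 0 ∧ v = t • T (phi u) := by
  have hT : Continuous T.symm := T.symm.toLinearMap.continuous_of_finiteDimensional
  have hc : Continuous (fun v => t0⁻¹ • T.symm v) := by fun_prop
  have h1 : (fun v => t0⁻¹ • T.symm v) (t0 • T (phi u0)) = phi u0 := by
    simp [smul_smul, ht0]
  have h2 := hc.continuousAt (x := t0 • T (phi u0))
  unfold ContinuousAt at h2
  rw [h1] at h2
  filter_upwards [h2.eventually (phi_open u0 O hO)] with v hv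
  obtain ⟨u, hu, t, ht, h3⟩ := hv
  refine ⟨u, hu, t0 * t, mul_ne_zero ht0 ht, ?_⟩
  rw [← smul_smul, ← map_smul, ← h3, map_smul, T.apply_symm_apply, smul_smul, mul_inv_cancel₀ ht0,
    one_smul]

end PartE3

section PartE4
open Set Topology

/-- The projective point of the chart. -/
def mkT (T : (Fin 3 → ℂ) ≃ₗ[ℂ] (Fin 3 → ℂ)) (u : ℂ × ℂ) : P2 :=
  Projectivization.mk ℂ (T (phi u)) (by
    rw [Ne, LinearEquiv.map_eq_zero_iff]; exact phi_ne u)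

theorem continuous_mkT (T : (Fin 3 → ℂ) ≃ₗ[ℂ] (Fin 3 → ℂ)) : Continuous (mkT T) := by
  have hT : Continuous T := T.toLinearMap.continuous_of_finiteDimensional
  have h1 : Continuous (fun u : ℂ × ℂ => (⟨T (phi u), by
    rw [Ne, LinearEquiv.map_eq_zero_iff]; exact phi_ne u⟩ : {v : Fin 3 → ℂ // v ≠ 0})) :=
    (hT.comp continuous_phi).subtype_mk _
  exact (continuous_quotient_mk' (s := projectivizationSetoid ℂ (Fin 3 → ℂ))).comp h1

theorem mkT_open (T : (Fin 3 → ℂ) ≃ₗ[ℂ] (Fin 3 → ℂ)) (O : Set (ℂ × ℂ)) (hO : IsOpen O) :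
    IsOpen (mkT T '' O) := by
  have : IsOpen ((fun v : {v : Fin 3 → ℂ // v ≠ 0} =>
      (Projectivization.mk ℂ v.1 v.2 : P2)) ⁻¹' (mkT T '' O)) := by
    rw [isOpen_iff_mem_nhds]
    rintro ⟨v, hv⟩ ⟨u, hu, hue⟩
    obtain ⟨t0, ht⟩ := (Projectivization.mk_eq_mk_iff' ℂ _ _ _ _).1 hue.symm
    have ht0 : t0 ≠ 0 := by
      rintro rfl; rw [zero_smul] at ht; exact hv ht.symm
    have h1 := phi_open_T T u O (hO.mem_nhds hu) t0 ht0
    change t0 • T (phi u) = v at ht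
    rw [ht] at h1
    have h2 := (continuous_subtype_val (p := fun v : Fin 3 → ℂ => v ≠ 0)).continuousAt
      (x := ⟨v, hv⟩)
    filter_upwards [h2.eventually h1] with w hw
    obtain ⟨u', hu', t, ht, hw⟩ := hw
    refine ⟨u', hu', ?_⟩
    exact ((Projectivization.mk_eq_mk_iff' ℂ _ _ _ _).2 ⟨t, hw.symm⟩).symm
  exact this

theorem mkT_eq (T : (Fin 3 → ℂ) ≃ₗ[ℂ] (Fin 3 → ℂ)) (u u' : ℂ × ℂ) (h : mkT T u = mkT T u') :
    u = u' ∨ (phi u' = -phi u ∧ u.1 ≠ 0 ∧ u' = tau u) := by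
  obtain ⟨t, ht⟩ := (Projectivization.mk_eq_mk_iff' ℂ _ _ _ _).1 h.symm
  rw [← map_smul] at ht
  have h1 := T.injective ht
  have h2 := congrArg q0 h1
  rw [q0_smul, q0_phi, q0_phi, mul_one] at h2
  rcases (sq_eq_sq_iff_eq_or_eq_neg (b := (1 : ℂ))).1 (by rw [h2, one_pow]) with h3 | h3
  · left; rw [h3, one_smul] at h1; exact phi_inj h1
  · right; rw [h3, neg_one_smul] at h1; exact ⟨h1.symm, phi_neg h1.symm⟩

theorem mkT_tau (T : (Fin 3 → ℂ) ≃ₗ[ℂ] (Fin 3 → ℂ)) (u : ℂ × ℂ) (h : u.1 ≠ 0) :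
    mkT T (tau u) = mkT T u :=
  (Projectivization.mk_eq_mk_iff' ℂ _ _ _ _).2 ⟨-1, by rw [phi_tau h]; simp⟩

theorem mkT_locinj (T : (Fin 3 → ℂ) ≃ₗ[ℂ] (Fin 3 → ℂ)) (u : ℂ × ℂ) :
    ∃ N : Set (ℂ × ℂ), IsOpen N ∧ u ∈ N ∧ InjOn (mkT T) N := by
  have hne : phi u ≠ -phi u := fun h => by
    have h1 : (2 : ℂ) • phi u = 0 := by
      rw [two_smul]; nth_rewrite 2 [h]; simp
    rcases smul_eq_zero.1 h1 with h2 | h2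
    · norm_num at h2
    · exact phi_ne u h2
  obtain ⟨A, B, hA, hB, huA, huB, hAB⟩ := t2_separation hne
  refine ⟨phi ⁻¹' A ∩ (fun u => -phi u) ⁻¹' B,
    (hA.preimage continuous_phi).inter (hB.preimage continuous_phi.neg), ⟨huA, huB⟩, ?_⟩
  rintro v ⟨hv1, hv2⟩ v' ⟨hv1', hv2'⟩ hvv
  rcases mkT_eq T v v' hvv with h | ⟨h, -, -⟩
  · exact h
  · exfalso
    have : phi v' ∈ B := by rw [h]; exact hv2
    exact Set.disjoint_left.1 hAB hv1' this

theorem mkT_surj (T : (Fin 3 → ℂ) ≃ₗ[ℂ] (Fin 3 → ℂ)) (v : Fin 3 → ℂ) (hv : v ≠ 0)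
    (hq : q0 (T.symm v) ≠ 0) : ∃ u, mkT T u = Projectivization.mk ℂ v hv := by
  obtain ⟨s, hs⟩ := IsAlgClosed.exists_pow_nat_eq (q0 (T.symm v)) (n := 2) (by norm_num)
  have hs0 : s ≠ 0 := by rintro rfl; apply hq; rw [← hs]; simp
  have h1 : ∃ t : ℂ, t ≠ 0 ∧ q0 (t • T.symm v) = 1 ∧
      ((t • T.symm v) 0 ≠ 0 ∨ 1 + (t • T.symm v) 2 ≠ 0) := by
    have hq1 : q0 (s⁻¹ • T.symm v) = 1 := by rw [q0_smul, ← hs]; field_simp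
    have hq2 : q0 ((-s⁻¹) • T.symm v) = 1 := by rw [q0_smul, ← hs]; field_simp
    by_cases hx : 1 + (s⁻¹ • T.symm v) 2 = 0
    · refine ⟨-s⁻¹, by simpa using hs0, hq2, Or.inr ?_⟩
      intro h
      have h3 : (1 + (s⁻¹ • T.symm v) 2) + (1 + ((-s⁻¹) • T.symm v) 2) = 0 := by rw [hx, h, add_zero]
      simp at h3
      ring_nf at h3
      norm_num at h3
    · exact ⟨s⁻¹, by simpa using hs0, hq1, Or.inr hx⟩
  obtain ⟨t, ht, hq1, hor⟩ := h1
  have : ∃ u, phi u = t • T.symm v := by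
    rcases hor with h | h
    · exact ⟨_, phi_chart1 _ hq1 h⟩
    · exact ⟨_, phi_chart2 _ hq1 h⟩
  obtain ⟨u, hu⟩ := this
  refine ⟨u, (Projectivization.mk_eq_mk_iff' ℂ _ _ _ _).2 ⟨t, ?_⟩⟩
  rw [hu]; simp

theorem core {r : ℕ} (p : Fin r → ℂ) (hp : ∀ i, 0 < (p i).re)
    (hinj : Function.Injective fun i => (p i).re)
    (T : (Fin 3 → ℂ) ≃ₗ[ℂ] (Fin 3 → ℂ)) (A : Set P2) (f : ℂ × ℂ → ℂ) (hf : Continuous f)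
    (hfτ : ∀ u : ℂ × ℂ, u.1 ≠ 0 → f (tau u) = -f u)
    (hf0 : ∀ u : ℂ × ℂ, u.1 = 0 → ∀ i, (f u).re ≠ (p i).re ∧ (f u).re ≠ -(p i).re)
    (hA1 : ∀ u, mkT T u ∈ A ↔ ∀ i, f u ≠ p i ∧ f u ≠ -p i)
    (hA2 : ∀ v hv, Projectivization.mk ℂ v hv ∈ A → q0 (T.symm v) ≠ 0)
    (hcontr : ContractibleSpace {u | f u ∈ slitPlane p})
    (hjoin : ∀ D : Set ℂ, Convex ℝ D → IsOpen D → ∀ u u' : ℂ × ℂ, u.1 ≠ 0 → u'.1 ≠ 0 →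
      f u ∈ D → f u' ∈ D → JoinedIn {u : ℂ × ℂ | u.1 ≠ 0 ∧ f u ∈ D} u u')
    (hsurjf : ∀ z : ℂ, z ≠ 0 → ∃ u : ℂ × ℂ, u.1 ≠ 0 ∧ f u = z) (x : A) :
    Nonempty (FundamentalGroup A x ≃* FZ r) := by
  classical
  have ha : ∀ i, 0 < (fun i => (p i).re) i := hp
  have hmem : ∀ u : {u | f u ∈ slitPlane p}, mkT T u.1 ∈ A := fun u =>
    (hA1 u.1).2 fun i => slitPlane_ne p _ u.2 i
  have hSo : IsOpen {u | f u ∈ slitPlane p} := (isOpen_slitPlane p).preimage hf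
  let π : {u | f u ∈ slitPlane p} → A := fun u => ⟨mkT T u.1, hmem u⟩
  have hπc : Continuous π := ((continuous_mkT T).comp continuous_subtype_val).subtype_mk _
  have hπo : IsOpenMap π := by
    intro O hO
    have h1 := mkT_open T (Subtype.val '' O) (hSo.isOpenMap_subtype_val O hO)
    convert h1.preimage (continuous_subtype_val (p := fun x => x ∈ A)) using 1
    ext y
    constructor
    · rintro ⟨u, hu, rfl⟩; exact ⟨u.1, ⟨u, hu, rfl⟩, rfl⟩
    · rintro ⟨_, ⟨u, hu, rfl⟩, h⟩; exact ⟨u, hu, Subtype.ext h⟩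
  have hπ : IsLocalHomeomorph π := by
    rw [isLocalHomeomorph_iff_isOpenEmbedding_restrict]
    intro u
    obtain ⟨N, hN, huN, hNi⟩ := mkT_locinj T u.1
    have hNo : IsOpen (Subtype.val ⁻¹' N : Set {u | f u ∈ slitPlane p}) :=
      hN.preimage continuous_subtype_val
    refine ⟨Subtype.val ⁻¹' N, hNo.mem_nhds huN, ?_⟩
    refine IsOpenEmbedding.of_continuous_injective_isOpenMap
      (hπc.comp continuous_subtype_val) ?_ (hπo.comp hNo.isOpenMap_subtype_val)
    rintro ⟨v, hv⟩ ⟨v', hv'⟩ hvv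
    exact Subtype.ext (Subtype.ext (hNi hv hv' (congrArg Subtype.val hvv)))
  let W : Set {u | f u ∈ slitPlane p} := {u | u.1.1 ≠ 0 ∧ -f u.1 ∈ slitPlane p}
  let τ : {u | f u ∈ slitPlane p} → {u | f u ∈ slitPlane p} := fun u =>
    if h : tau u.1 ∈ {u | f u ∈ slitPlane p} then ⟨tau u.1, h⟩ else u
  have hτv : ∀ u ∈ W, (τ u).1 = tau u.1 := fun u hu => by
    have : tau u.1 ∈ {u | f u ∈ slitPlane p} := by
      show f (tau u.1) ∈ slitPlane p
      rw [hfτ _ hu.1]; exact hu.2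
    simp only [τ]; rw [dif_pos this]
  have hWre : ∀ u ∈ W, ∀ i, (f u.1).re ≠ (p i).re ∧ (f u.1).re ≠ -(p i).re := fun u hu =>
    (slitPlane_inter_neg p _).1 ⟨u.2, hu.2⟩
  have hWof : ∀ u : ℂ × ℂ, u.1 ≠ 0 → (∀ i, (f u).re ≠ (p i).re ∧ (f u).re ≠ -(p i).re) →
      ∃ h : f u ∈ slitPlane p, (⟨u, h⟩ : {u | f u ∈ slitPlane p}) ∈ W := fun u hu h => by
    have := (slitPlane_inter_neg p _).2 h
    exact ⟨this.1, hu, this.2⟩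
  have hW0 : ∀ z : ℝ, z ≠ 0 → (∀ i, z ≠ (p i).re ∧ z ≠ -(p i).re) → ∃ u ∈ W, (f u.1).re = z :=
    fun z hz h => by
      obtain ⟨u, hu, hfu⟩ := hsurjf z (by exact_mod_cast hz)
      have hre : (f u).re = z := by rw [hfu]; simp
      obtain ⟨h1, h2⟩ := hWof u hu (by rw [hre]; exact h)
      exact ⟨⟨u, h1⟩, h2, hre⟩
  have hτne0 : ∀ u : ℂ × ℂ, u.1 ≠ 0 → tau u ≠ u := fun u hu h => by
    have := congrArg Prod.fst h
    simp only [tau] at this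
    exact hu (self_eq_neg.1 this.symm)
  have : ContractibleSpace {u | f u ∈ slitPlane p} := hcontr
  have hτW : ∀ u ∈ W, τ u ∈ W := fun u hu => by
    refine ⟨?_, ?_⟩
    · rw [hτv u hu]; simpa [tau] using hu.1
    · rw [hτv u hu, hfτ _ hu.1, neg_neg]; exact u.2
  refine glued_fundamentalGroup r π hπ ?_ W τ (fun u => stripLabel (fun i => (p i).re) (f u.1).re)
    ?_ hτW ?_ ?_ ?_ ?_ ?_ ?_ ?_ ?_ ?_ ?_ x
  · -- surjectivity
    rintro ⟨y, hy⟩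
    induction y using Projectivization.ind with
    | h v hv =>
    obtain ⟨u, hu⟩ := mkT_surj T v hv (hA2 v hv hy)
    have h1 := (hA1 u).1 (by rw [hu]; exact hy)
    by_cases hx : u.1 = 0
    · exact ⟨⟨u, ((slitPlane_inter_neg p _).2 (hf0 u hx)).1⟩, Subtype.ext hu⟩
    · rcases slitPlane_or_neg p hp hinj _ h1 with h2 | h2
      · exact ⟨⟨u, h2⟩, Subtype.ext hu⟩
      · exact ⟨⟨tau u, by show f (tau u) ∈ slitPlane p; rw [hfτ _ hx]; exact h2⟩,
          Subtype.ext ((mkT_tau T u hx).trans hu)⟩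
  · -- continuity of the involution
    rw [continuousOn_iff_continuous_domRestrict]
    have : Continuous (fun w : W => tau w.1.1) := by
      unfold tau
      refine Continuous.prodMk (by fun_prop) ?_
      refine Continuous.sub (by fun_prop) ?_
      exact Continuous.div continuous_const (by fun_prop) fun w => w.2.1
    refine continuous_induced_rng.2 (this.congr fun w => (hτv w.1 w.2).symm)
  · intro u hu
    apply Subtype.ext
    rw [hτv _ (hτW u hu), hτv u hu, tau_tau hu.1]
  · intro u hu h
    exact hτne0 u.1 hu.1 ((hτv u hu).symm.trans (congrArg Subtype.val h))
  · intro u hu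
    apply Subtype.ext
    show mkT T (τ u).1 = mkT T u.1
    rw [hτv u hu, mkT_tau T _ hu.1]
  · intro u u' h
    rcases mkT_eq T u.1 u'.1 (congrArg Subtype.val h) with h1 | ⟨-, h1, h2⟩
    · exact Or.inl (Subtype.ext h1)
    · have hu : u ∈ W := ⟨h1, by rw [← hfτ _ h1, ← h2]; exact u'.2⟩
      exact Or.inr ⟨hu, Subtype.ext (by rw [hτv u hu]; exact h2)⟩
  · intro u hu
    obtain ⟨I, hI, -, hmI, hIl, -, -⟩ := strip_interval ha hinj (hWre u hu)
    have hc : Continuous fun u : {u | f u ∈ slitPlane p} => (f u.1).re := by fun_prop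
    filter_upwards [(hI.preimage hc).mem_nhds hmI] with u' hu'
    exact hIl _ hu'
  · intro u hu
    show stripLabel _ (f (τ u).1).re = _
    rw [hτv u hu, hfτ _ hu.1, Complex.neg_re]
    exact stripLabel_neg ha hinj (hWre u hu)
  · intro u hu
    rcases strip_cases ha hinj (hWre u hu) with h | ⟨i, h⟩ | ⟨i, h⟩
    · left; exact stripLabel_of_small ha hinj h
    · right; exact ⟨i, Or.inl (stripLabel_of_inStrip ha hinj h)⟩
    · right; exact ⟨i, Or.inr (stripLabel_of_inStrip_neg ha hinj h)⟩
  · obtain ⟨t, ht, hts⟩ := exists_small ha hinj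
    obtain ⟨u, hu, hre⟩ := hW0 t ht.ne' fun i => by
      have := abs_lt.1 (hts i)
      exact ⟨this.2.ne, this.1.ne'⟩
    refine ⟨u, hu, ?_⟩
    show stripLabel _ (f u.1).re = _
    rw [hre]; exact stripLabel_of_small ha hinj hts
  · intro i
    obtain ⟨t, ht, hts⟩ := exists_inStrip ha hinj i
    obtain ⟨u, hu, hre⟩ := hW0 t ht.ne' fun k => by
      refine ⟨fun h => ?_, fun h => ?_⟩
      · rcases lt_or_ge (p i).re (p k).re with h1 | h1
        · exact (hts.2 k h1).ne h
        · have h2 : (p i).re < t := hts.1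
          linarith
      · have := hp k
        linarith
    refine ⟨u, hu, ?_⟩
    show stripLabel _ (f u.1).re = _
    rw [hre]; exact stripLabel_of_inStrip ha hinj hts
  · intro u hu u' hu' h
    obtain ⟨I, hI, hIo, hmI, hIl, hIn, hIm⟩ := strip_interval ha hinj (hWre u hu)
    have hm' := hIm _ (hWre u' hu') h.symm
    obtain ⟨γ, hγ⟩ := hjoin (Complex.re ⁻¹' I) (hIo.convex.is_linear_preimage
      Complex.reLm.isLinear) (hI.preimage Complex.continuous_re) u.1 u'.1 hu.1 hu'.1 hmI hm'
    have hγW : ∀ t, ∃ h : f (γ t) ∈ slitPlane p, (⟨γ t, h⟩ : {u | f u ∈ slitPlane p}) ∈ W :=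
      fun t => hWof _ (hγ t).1 (hIn _ (hγ t).2)
    refine ⟨⟨⟨fun t => ⟨γ t, (hγW t).1⟩, γ.continuous.subtype_mk _⟩, ?_, ?_⟩, fun t => (hγW t).2⟩
    · exact Subtype.ext γ.source
    · exact Subtype.ext γ.target

end PartE4

section PartF1
open Set Topology
open scoped Matrix

/-- Quadratic form of a matrix, as a function. -/
def qf (M : Matrix (Fin 3) (Fin 3) ℂ) (v : Fin 3 → ℂ) : ℂ :=
  ∑ j : Fin 3, ∑ k : Fin 3, M j k * (v j * v k)

theorem qf_eq (M : Matrix (Fin 3) (Fin 3) ℂ) (v : Fin 3 → ℂ) : qf M v = v ⬝ᵥ (M *ᵥ v) := by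
  simp only [qf, dotProduct, Matrix.mulVec, Finset.mul_sum]
  refine Finset.sum_congr rfl fun j _ => Finset.sum_congr rfl fun k _ => ?_
  ring

theorem qf_smul (M : Matrix (Fin 3) (Fin 3) ℂ) (t : ℂ) (v : Fin 3 → ℂ) :
    qf M (t • v) = t ^ 2 * qf M v := by
  rw [qf_eq, qf_eq, Matrix.mulVec_smul, smul_dotProduct, dotProduct_smul]
  simp only [smul_eq_mul]; ring

theorem qf_nondeg (M : Matrix (Fin 3) (Fin 3) ℂ) (hM : M.IsSymm) (hd : M.det ≠ 0)
    (w : Fin 3 → ℂ) (h : ∀ v, qf M (v + w) = qf M v) : w = 0 := by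
  have h0 : qf M w = 0 := by
    have := h 0
    rw [zero_add] at this
    rw [this]; simp [qf]
  have h1 : ∀ v, v ⬝ᵥ (M *ᵥ w) = 0 := fun v => by
    have h2 := h v
    rw [qf_eq] at h0
    rw [qf_eq, qf_eq, Matrix.mulVec_add, add_dotProduct, dotProduct_add, dotProduct_add, h0] at h2
    have h3 : w ⬝ᵥ (M *ᵥ v) = v ⬝ᵥ (M *ᵥ w) := by
      rw [Matrix.dotProduct_mulVec, ← Matrix.mulVec_transpose, hM.eq, dotProduct_comm]
    rw [h3] at h2
    have h4 : 2 * (v ⬝ᵥ (M *ᵥ w)) = 0 := by linear_combination h2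
    simpa using h4
  have h2 : M *ᵥ w = 0 := by
    ext i
    have := h1 (Pi.single i 1)
    simpa using this
  exact Matrix.eq_zero_of_mulVec_eq_zero hd h2

theorem qf_diag (M : Matrix (Fin 3) (Fin 3) ℂ) (hM : M.IsSymm) (hd : M.det ≠ 0) :
    ∃ S : (Fin 3 → ℂ) ≃ₗ[ℂ] (Fin 3 → ℂ), ∀ w, qf M (S w) = w ⬝ᵥ w := by
  let B : LinearMap.BilinForm ℂ (Fin 3 → ℂ) := Matrix.toBilin' M
  have hB : ∀ v w, B v w = v ⬝ᵥ (M *ᵥ w) := fun v w => by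
    simp only [B]; rw [Matrix.toBilin'_apply']
  have hsymm : ∀ v w, B v w = B w v := fun v w => by
    rw [hB, hB, Matrix.dotProduct_mulVec, ← Matrix.mulVec_transpose, hM.eq, dotProduct_comm]
  have hass : QuadraticMap.associated (R := ℂ) B.toQuadraticMap = B :=
    QuadraticMap.associated_left_inverse ℂ hsymm
  have hsep : (QuadraticMap.associated (R := ℂ) B.toQuadraticMap).SeparatingLeft := by
    rw [hass]
    intro v hv
    apply qf_nondeg M hM hd
    intro w
    have h1 : w ⬝ᵥ (M *ᵥ v) = 0 := by rw [← hB]; rw [hsymm]; exact hv w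
    have h2 : v ⬝ᵥ (M *ᵥ w) = 0 := by rw [← hB]; exact hv w
    have h3 : v ⬝ᵥ (M *ᵥ v) = 0 := by rw [← hB]; exact hv v
    rw [qf_eq, qf_eq, Matrix.mulVec_add, add_dotProduct, dotProduct_add, dotProduct_add, h1, h2, h3]
    ring
  have key := QuadraticForm.equivalent_weightedSumSquares_of_isAlgClosed B.toQuadraticMap hsep
  have gen : ∀ n, n = 3 → QuadraticMap.Equivalent B.toQuadraticMap
      (QuadraticMap.weightedSumSquares ℂ (1 : Fin n → ℂ)) →
      ∃ S : (Fin 3 → ℂ) ≃ₗ[ℂ] (Fin 3 → ℂ), ∀ w, qf M (S w) = w ⬝ᵥ w := by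
    rintro n rfl ⟨e⟩
    refine ⟨e.symm.toLinearEquiv, fun w => ?_⟩
    have h1 := e.symm.map_app w
    rw [LinearMap.BilinMap.toQuadraticMap_apply, hB] at h1
    rw [qf_eq]
    refine h1.trans ?_
    simp [QuadraticMap.weightedSumSquares_apply, dotProduct]
  exact gen _ (by simp) key

/-- The linear map of a frame. -/
def frameMap (e₁ e₂ e₃ : Fin 3 → ℂ) : (Fin 3 → ℂ) →ₗ[ℂ] (Fin 3 → ℂ) where
  toFun w := w 0 • e₁ + w 1 • e₂ + w 2 • e₃
  map_add' v w := by simp only [Pi.add_apply, add_smul]; abel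
  map_smul' t w := by simp only [Pi.smul_apply, smul_eq_mul, mul_smul, smul_add, RingHom.id_apply]

theorem frameMap_apply (e₁ e₂ e₃ w : Fin 3 → ℂ) :
    frameMap e₁ e₂ e₃ w = w 0 • e₁ + w 1 • e₂ + w 2 • e₃ := rfl

theorem frameMap_q (e₁ e₂ e₃ : Fin 3 → ℂ) (h11 : e₁ ⬝ᵥ e₁ = 0) (h22 : e₂ ⬝ᵥ e₂ = 0)
    (h33 : e₃ ⬝ᵥ e₃ = 1) (h12 : e₁ ⬝ᵥ e₂ = 1 / 2) (h13 : e₁ ⬝ᵥ e₃ = 0) (h23 : e₂ ⬝ᵥ e₃ = 0)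
    (w : Fin 3 → ℂ) : frameMap e₁ e₂ e₃ w ⬝ᵥ frameMap e₁ e₂ e₃ w = q0 w := by
  have h21 : e₂ ⬝ᵥ e₁ = 1 / 2 := by rw [dotProduct_comm, h12]
  have h31 : e₃ ⬝ᵥ e₁ = 0 := by rw [dotProduct_comm, h13]
  have h32 : e₃ ⬝ᵥ e₂ = 0 := by rw [dotProduct_comm, h23]
  rw [frameMap_apply]
  simp only [add_dotProduct, dotProduct_add, smul_dotProduct, dotProduct_smul, h11, h22, h33, h12,
    h13, h23, h21, h31, h32, smul_eq_mul, q0]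
  ring

theorem exists_frame (d : Fin 3 → ℂ) (hd : d ≠ 0) :
    ∃ R : (Fin 3 → ℂ) →ₗ[ℂ] (Fin 3 → ℂ), (∀ w, R w ⬝ᵥ R w = q0 w) ∧
      ∃ c : ℂ, c ≠ 0 ∧ ((∀ w, d ⬝ᵥ R w = c * w 0) ∨ (∀ w, d ⬝ᵥ R w = c * w 2)) := by
  by_cases hdd : d ⬝ᵥ d = 0
  · obtain ⟨i, hi⟩ : ∃ i, d i ≠ 0 := by
      by_contra hc; push Not at hc; exact hd (funext hc)
    let v : Fin 3 → ℂ := (1 / (2 * d i)) • Pi.single i 1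
    have hv : d ⬝ᵥ v = 1 / 2 := by
      simp only [v, dotProduct_smul, dotProduct_single, smul_eq_mul]; field_simp
    have hv' : v ⬝ᵥ d = 1 / 2 := by rw [dotProduct_comm, hv]
    let e : Fin 3 → ℂ := v - (v ⬝ᵥ v) • d
    have hee : e ⬝ᵥ e = 0 := by
      simp only [e, sub_dotProduct, dotProduct_sub, smul_dotProduct, dotProduct_smul, hv, hv', hdd,
        smul_eq_mul]; ring
    have hde : d ⬝ᵥ e = 1 / 2 := by
      simp only [e, dotProduct_sub, dotProduct_smul, hv, hdd, smul_eq_mul]; ring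
    have hed : e ⬝ᵥ d = 1 / 2 := by rw [dotProduct_comm, hde]
    let g : Fin 3 → ℂ := (2 * Complex.I) • (e ⨯₃ d)
    have hgg : g ⬝ᵥ g = 1 := by
      simp only [g, smul_dotProduct, dotProduct_smul, cross_dot_cross, hee, hdd, hde, hed,
        smul_eq_mul]
      linear_combination -Complex.I_sq
    have heg : e ⬝ᵥ g = 0 := by simp only [g, dotProduct_smul, dot_self_cross, smul_zero]
    have hdg : d ⬝ᵥ g = 0 := by simp only [g, dotProduct_smul, dot_cross_self, smul_zero]
    refine ⟨frameMap e d g, frameMap_q e d g hee hdd hgg hed heg hdg, 1 / 2, by norm_num,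
      Or.inl fun w => ?_⟩
    rw [frameMap_apply]
    simp only [dotProduct_add, dotProduct_smul, hde, hdd, hdg, smul_eq_mul]; ring
  · obtain ⟨c, hc⟩ := IsAlgClosed.exists_pow_nat_eq (d ⬝ᵥ d) (n := 2) (by norm_num)
    have hc0 : c ≠ 0 := by rintro rfl; apply hdd; rw [← hc]; simp
    let g : Fin 3 → ℂ := c⁻¹ • d
    have hgg : g ⬝ᵥ g = 1 := by
      simp only [g, smul_dotProduct, dotProduct_smul, smul_eq_mul, ← hc]; field_simp
    have hdg : ∀ v, d ⬝ᵥ v = c * (g ⬝ᵥ v) := fun v => by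
      simp only [g, smul_dotProduct, smul_eq_mul]; field_simp
    have : ∃ a0 : Fin 3 → ℂ, g ⬝ᵥ a0 = 0 ∧ a0 ⬝ᵥ a0 ≠ 0 := by
      by_contra hcon
      push Not at hcon
      have h3 : ∀ i : Fin 3, 1 - g i * g i = 0 := fun i => by
        have := hcon (g ⨯₃ Pi.single i 1) (dot_self_cross _ _)
        rw [cross_dot_cross, hgg] at this
        simpa using this
      have h4 := hgg
      simp only [dotProduct, Fin.sum_univ_three] at h4
      have : (2 : ℂ) = 0 := by linear_combination h3 0 + h3 1 + h3 2 + h4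
      norm_num at this
    obtain ⟨a0, hga0, haa0⟩ := this
    obtain ⟨s, hs⟩ := IsAlgClosed.exists_pow_nat_eq (a0 ⬝ᵥ a0) (n := 2) (by norm_num)
    have hs0 : s ≠ 0 := by rintro rfl; apply haa0; rw [← hs]; simp
    let a : Fin 3 → ℂ := s⁻¹ • a0
    have haa : a ⬝ᵥ a = 1 := by
      simp only [a, smul_dotProduct, dotProduct_smul, smul_eq_mul, ← hs]; field_simp
    have hga : g ⬝ᵥ a = 0 := by simp only [a, dotProduct_smul, hga0, smul_zero]
    have hag : a ⬝ᵥ g = 0 := by rw [dotProduct_comm, hga]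
    let b : Fin 3 → ℂ := g ⨯₃ a
    have hbb : b ⬝ᵥ b = 1 := by
      simp only [b, cross_dot_cross, hgg, haa, hga]; ring
    have hgb : g ⬝ᵥ b = 0 := dot_self_cross _ _
    have hbg : b ⬝ᵥ g = 0 := by rw [dotProduct_comm, hgb]
    have hab : a ⬝ᵥ b = 0 := dot_cross_self _ _
    have hba : b ⬝ᵥ a = 0 := by rw [dotProduct_comm, hab]
    refine ⟨frameMap ((1 / 2 : ℂ) • (a + Complex.I • b)) ((1 / 2 : ℂ) • (a - Complex.I • b)) g,
      frameMap_q _ _ _ ?_ ?_ hgg ?_ ?_ ?_, c, hc0, Or.inr fun w => ?_⟩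
    · simp only [add_dotProduct, dotProduct_add, smul_dotProduct, dotProduct_smul, haa, hbb, hab,
        hba, smul_eq_mul]
      linear_combination (1 / 4) * Complex.I_sq
    · simp only [sub_dotProduct, dotProduct_sub, smul_dotProduct, dotProduct_smul, haa, hbb, hab,
        hba, smul_eq_mul]
      linear_combination (1 / 4) * Complex.I_sq
    · simp only [add_dotProduct, dotProduct_sub, smul_dotProduct, dotProduct_smul, haa, hbb, hab,
        hba, smul_eq_mul]
      linear_combination -(1 / 4) * Complex.I_sq
    · simp only [add_dotProduct, smul_dotProduct, hag, hbg, smul_eq_mul]; ring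
    · simp only [sub_dotProduct, smul_dotProduct, hag, hbg, smul_eq_mul]; ring
    · rw [hdg, frameMap_apply]
      simp only [dotProduct_add, dotProduct_sub, dotProduct_smul, hga, hgb, hgg, smul_eq_mul]
      ring

theorem normal_form (M : Matrix (Fin 3) (Fin 3) ℂ) (hM : M.IsSymm) (hd : M.det ≠ 0)
    (d : Fin 3 → ℂ) (hd0 : d ≠ 0) :
    ∃ T : (Fin 3 → ℂ) ≃ₗ[ℂ] (Fin 3 → ℂ), (∀ w, qf M (T w) = q0 w) ∧
      ∃ c : ℂ, c ≠ 0 ∧ ((∀ w, d ⬝ᵥ T w = c * w 0) ∨ (∀ w, d ⬝ᵥ T w = c * w 2)) := by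
  obtain ⟨S, hS⟩ := qf_diag M hM hd
  let d' : Fin 3 → ℂ := fun i => d ⬝ᵥ S (Pi.single i 1)
  have hd' : ∀ w, d ⬝ᵥ S w = d' ⬝ᵥ w := fun w => by
    have h1 : S w = ∑ i, w i • S (Pi.single i 1) := by
      conv_lhs => rw [pi_eq_sum_univ' w]
      rw [map_sum]
      refine Finset.sum_congr rfl fun i _ => ?_
      rw [← map_smul]
    rw [h1, dotProduct_sum]
    simp only [dotProduct_smul, smul_eq_mul, d']
    simp only [dotProduct]
    refine Finset.sum_congr rfl fun i _ => mul_comm _ _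
  have hd'0 : d' ≠ 0 := fun h => by
    apply hd0
    ext i
    have h1 := hd' (S.symm (Pi.single i 1))
    rw [h, zero_dotProduct, S.apply_symm_apply] at h1
    simpa using h1
  obtain ⟨R, hR, c, hc, hor⟩ := exists_frame d' hd'0
  have hinj : Function.Injective R := by
    rw [← LinearMap.ker_eq_bot, LinearMap.ker_eq_bot']
    intro w hw
    have h1 : ∀ v, q0 (v + w) = q0 v := fun v => by
      rw [← hR, ← hR, map_add, hw, add_zero]
    have ha := h1 0
    have hb := h1 ![1, 0, 0]
    have hc := h1 ![0, 1, 0]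
    have hd := h1 ![0, 0, 1]
    simp [q0] at ha hb hc hd
    have e1 : w 1 = 0 := by linear_combination hb - ha
    have e0 : w 0 = 0 := by linear_combination hc - ha
    have e2 : w 2 = 0 := by linear_combination (hd - ha) / 2
    ext i
    fin_cases i
    · exact e0
    · exact e1
    · exact e2
  have hRe : ∀ w, LinearEquiv.ofInjectiveEndo R hinj w = R w := fun w => rfl
  refine ⟨(LinearEquiv.ofInjectiveEndo R hinj).trans S, fun w => ?_, c, hc, ?_⟩
  · simp only [LinearEquiv.trans_apply, hRe]
    rw [hS, hR]
  · simp only [LinearEquiv.trans_apply, hd', hRe]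
    exact hor

end PartF1

section PartF2
open Set Topology
open scoped Matrix

theorem generic_rotation (E : Set ℂ) (hE : E.Finite) :
    ∃ ω : ℂ, ω ≠ 0 ∧ ∀ z ∈ E, ∀ w ∈ E, (ω * z).re = (ω * w).re → z = w := by
  have hbad : (⋃ z ∈ E, ⋃ w ∈ E, {t : ℝ | z ≠ w ∧ (z - w).re = t * (z - w).im}).Finite := by
    refine hE.biUnion fun z _ => hE.biUnion fun w _ => Set.Subsingleton.finite ?_
    rintro t ⟨hzw, ht⟩ t' ⟨-, ht'⟩
    have him : (z - w).im ≠ 0 := by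
      intro h
      rw [h, mul_zero] at ht
      exact hzw (sub_eq_zero.1 (Complex.ext ht h))
    exact mul_right_cancel₀ him (ht.symm.trans ht')
  obtain ⟨t, ht⟩ := hbad.infinite_compl.nonempty
  refine ⟨⟨1, t⟩, fun h => ?_, fun z hz w hw h => ?_⟩
  · have := congrArg Complex.re h
    simp at this
  · by_contra hne
    apply ht
    simp only [mem_iUnion]
    refine ⟨z, hz, w, hw, hne, ?_⟩
    simp only [Complex.mul_re, one_mul] at h
    simp only [Complex.sub_re, Complex.sub_im]
    linarith

theorem eval_linear (f : MvPolynomial (Fin 3) ℂ) (hf : f.IsHomogeneous 1) :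
    ∃ d : Fin 3 → ℂ, ∀ v, eval v f = d ⬝ᵥ v := by
  have h1 : ∀ m ∈ f.support, ∃ i, ∀ j, m j = if j = i then 1 else 0 := fun m hm => by
    have h2 : m.degree = 1 := by
      have := hf (mem_support_iff.1 hm)
      rwa [Finsupp.degree_eq_weight_one]
    rw [Finsupp.degree_eq_sum, Fin.sum_univ_three] at h2
    have h3 : (m 0 = 1 ∧ m 1 = 0 ∧ m 2 = 0) ∨ (m 0 = 0 ∧ m 1 = 1 ∧ m 2 = 0) ∨
        (m 0 = 0 ∧ m 1 = 0 ∧ m 2 = 1) := by omega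
    rcases h3 with ⟨ha, hb, hc⟩ | ⟨ha, hb, hc⟩ | ⟨ha, hb, hc⟩
    · exact ⟨0, fun j => by fin_cases j <;> simp [ha, hb, hc]⟩
    · exact ⟨1, fun j => by fin_cases j <;> simp [ha, hb, hc]⟩
    · exact ⟨2, fun j => by fin_cases j <;> simp [ha, hb, hc]⟩
  have h2 : ∀ m ∈ f.support, ∃ i, ∀ v : Fin 3 → ℂ, ∏ j, v j ^ m j = v i := fun m hm => by
    obtain ⟨i, hi⟩ := h1 m hm
    refine ⟨i, fun v => ?_⟩
    rw [Finset.prod_eq_single i]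
    · rw [hi]; simp
    · intro j _ hj; rw [hi, if_neg hj, pow_zero]
    · simp
  refine ⟨fun i => eval (Pi.single i 1) f, fun v => ?_⟩
  simp only [eval_eq', dotProduct, Finset.sum_mul]
  rw [Finset.sum_comm]
  refine Finset.sum_congr rfl fun m hm => ?_
  obtain ⟨i, hi⟩ := h2 m hm
  rw [hi]
  simp only [hi]
  rw [Finset.sum_eq_single i]
  · simp
  · intro j _ hj; simp [Pi.single_apply, Ne.symm hj]
  · simp

theorem final {r : ℕ} (d : Fin 3 → ℂ) (hd0 : d ≠ 0) (F : (Fin 3 → ℂ) → ℂ)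
    (a b : Fin (r + 1) → ℂ)
    (hab : ∀ i j, a i ≠ 0 → a j ≠ 0 → a i * b j = a j * b i → i = j)
    (M : Fin (r + 1) → Matrix (Fin 3) (Fin 3) ℂ) (hM : ∀ i, (M i).IsSymm)
    (hMd : ∀ i, (M i).det ≠ 0)
    (hF : ∀ i v, qf (M i) v = a i * F v + b i * (d ⬝ᵥ v) ^ 2)
    (A : Set P2) (hA : ∀ v hv, Projectivization.mk ℂ v hv ∈ A ↔ ∀ i, qf (M i) v ≠ 0) (x : A) :
    Nonempty (FundamentalGroup A x ≃* FZ r) := by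
  obtain ⟨T, hT, c, hc, hor⟩ := normal_form (M 0) (hM 0) (hMd 0) d hd0
  have ha : ∀ i, a i ≠ 0 := fun i hi => by
    have h1 : d ⬝ᵥ T ![0, 1, 0] = 0 := by
      rcases hor with h | h <;> rw [h] <;> simp
    have h2 := qf_nondeg (M i) (hM i) (hMd i) (T ![0, 1, 0]) fun v => by
      rw [hF, hF, hi, dotProduct_add, h1]; ring
    rw [LinearEquiv.map_eq_zero_iff] at h2
    have := congrFun h2 1
    simp at this
  let k : Fin r → ℂ := fun i => a 0 * b i.succ - a i.succ * b 0
  have hk : ∀ i, k i ≠ 0 := fun i h => by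
    have := hab 0 i.succ (ha _) (ha _) (sub_eq_zero.1 h)
    exact (Fin.succ_ne_zero i) this.symm
  have hkF : ∀ i v, a 0 * qf (M i.succ) v = a i.succ * qf (M 0) v + k i * (d ⬝ᵥ v) ^ 2 :=
    fun i v => by rw [hF, hF]; simp only [k]; ring
  let e : Fin r → ℂ := fun i => -a i.succ / k i
  have he : ∀ i, k i * e i = -a i.succ := fun i => by simp only [e]; field_simp [hk i]
  have he0 : ∀ i, e i ≠ 0 := fun i => div_ne_zero (neg_ne_zero.2 (ha _)) (hk i)
  have heinj : ∀ i j, e i = e j → i = j := fun i j h => by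
    have h1 := he i
    have h2 := he j
    rw [← h] at h2
    have h3 : a 0 * (a i.succ * b j.succ - a j.succ * b i.succ) = 0 := by
      have h4 : e i * (a i.succ * k j - a j.succ * k i) = 0 := by
        linear_combination a i.succ * h2 - a j.succ * h1
      have h5 := (mul_eq_zero.1 h4).resolve_left (he0 i)
      simp only [k] at h5
      linear_combination h5
    have h4 := (mul_eq_zero.1 h3).resolve_left (ha 0)
    exact Fin.succ_injective _ (hab _ _ (ha _) (ha _) (sub_eq_zero.1 h4))
  choose s hs using fun i => IsAlgClosed.exists_pow_nat_eq (e i) (n := 2) (by norm_num)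
  obtain ⟨ω, hω0, hω⟩ := generic_rotation
    ({0, c} ∪ (range s ∪ range (fun i => -s i))) (by
      refine ((Set.toFinite _)).union ((Set.finite_range s).union (Set.finite_range _)))
  have hchoice : ∀ i, ∃ σ : ℂ, σ ^ 2 = e i ∧ (σ ∈ range s ∪ range (fun i => -s i)) ∧
      (-σ ∈ range s ∪ range (fun i => -s i)) ∧ 0 < (ω * σ).re := fun i => by
    have hs0 : s i ≠ 0 := fun h => he0 i (by rw [← hs, h]; simp)
    have hne : (ω * s i).re ≠ 0 := fun h => by
      refine hs0 (hω _ (Or.inr (Or.inl ⟨i, rfl⟩)) 0 (Or.inl (Or.inl rfl)) ?_)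
      rw [h]; simp
    rcases lt_or_gt_of_ne hne with h | h
    · refine ⟨-s i, by rw [neg_sq, hs], Or.inr ⟨i, rfl⟩, Or.inl ⟨i, (neg_neg _).symm⟩, ?_⟩
      rw [mul_neg, Complex.neg_re]; linarith
    · exact ⟨s i, hs i, Or.inl ⟨i, rfl⟩, Or.inr ⟨i, rfl⟩, h⟩
  choose σ hσ hσm hσm' hσp using hchoice
  let p : Fin r → ℂ := fun i => ω * σ i
  have hp : ∀ i, 0 < (p i).re := hσp
  have hinj : Function.Injective fun i => (p i).re := fun i j h => by
    have := hω _ (Or.inr (hσm i)) _ (Or.inr (hσm j)) h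
    apply heinj
    rw [← hσ, ← hσ, this]
  -- membership in the chart
  have hmem : ∀ u (z : ℂ), z = ω * (d ⬝ᵥ T (phi u)) →
      (mkT T u ∈ A ↔ ∀ i, z ≠ p i ∧ z ≠ -p i) := fun u z hz => by
    unfold mkT
    rw [hA]
    have h0 : qf (M 0) (T (phi u)) = 1 := by rw [hT, q0_phi]
    have key : ∀ i : Fin r, qf (M i.succ) (T (phi u)) = 0 ↔ (z = p i ∨ z = -p i) := fun i => by
      have h1 := hkF i (T (phi u))
      rw [h0] at h1
      rw [← sq_eq_sq_iff_eq_or_eq_neg]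
      simp only [p, hz, mul_pow, hσ]
      rw [mul_right_inj' (pow_ne_zero 2 hω0)]
      constructor
      · intro h
        rw [h] at h1
        apply mul_left_cancel₀ (hk i)
        linear_combination -h1 - he i
      · intro h
        apply mul_left_cancel₀ (ha 0)
        rw [h1, h]
        linear_combination he i
    constructor
    · intro h i
      have := h i.succ
      rw [Ne, key] at this
      exact not_or.1 this
    · intro h i
      refine Fin.cases ?_ (fun i => ?_) i
      · rw [h0]; exact one_ne_zero
      · rw [Ne, key]; exact not_or.2 (h i)
  have hA2 : ∀ v hv, Projectivization.mk ℂ v hv ∈ A → q0 (T.symm v) ≠ 0 := fun v hv h => by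
    have := (hA v hv).1 h 0
    rwa [← T.apply_symm_apply v, hT] at this
  have hl0 : ω * c ≠ 0 := mul_ne_zero hω0 hc
  rcases hor with hor | hor
  · -- tangent case
    refine core p hp hinj T A (fun u => ω * c * u.1) (by fun_prop) ?_ ?_ ?_ hA2
      (contractible_tangent p _ hp) ?_ ?_ x
    · intro u hu; simp [tau]
    · intro u hu i
      have := hp i
      simp only [hu, mul_zero, Complex.zero_re]
      exact ⟨by linarith, by linarith⟩
    · intro u
      exact hmem u _ (by rw [hor]; simp [phi]; ring)
    · intro D hD hDo u u' hu hu' h h'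
      exact joined_tangent _ hl0 D hD hDo u u' hu hu' h h'
    · intro z hz
      exact ⟨(z / (ω * c), 0), div_ne_zero hz hl0, by field_simp⟩
  · -- transversal case
    have hcs : ∀ i, c ^ 2 ≠ e i := fun i h => by
      have h1 : ∀ w : Fin 3 → ℂ, qf (M i.succ) (T w) = a i.succ / a 0 * (w 0 * w 1) := fun w => by
        have h2 := hkF i (T w)
        rw [hor, hT] at h2
        apply mul_left_cancel₀ (ha 0)
        rw [h2]
        have h3 := he i
        rw [← h] at h3
        field_simp [ha 0]
        unfold q0
        linear_combination (w 2) ^ 2 * h3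
      have h2 := qf_nondeg (M i.succ) (hM _) (hMd _) (T ![0, 0, 1]) fun v => by
        rw [← T.apply_symm_apply v, ← map_add, h1, h1]
        simp
      rw [LinearEquiv.map_eq_zero_iff] at h2
      have := congrFun h2 2
      simp at this
    have hlre : ∀ i, (ω * c).re ≠ (p i).re ∧ (ω * c).re ≠ -(p i).re := fun i => by
      refine ⟨fun h => hcs i ?_, fun h => hcs i ?_⟩
      · rw [← hσ, hω c (Or.inl (Or.inr rfl)) (σ i) (Or.inr (hσm i)) h]
      · rw [← hσ, hω c (Or.inl (Or.inr rfl)) (-σ i) (Or.inr (hσm' i)) (by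
          rw [h, mul_neg, Complex.neg_re]), neg_sq]
    refine core p hp hinj T A (fun u => ω * c * (1 - u.1 * u.2)) (by fun_prop) ?_ ?_ ?_ hA2
      (contractible_transversal p _ hlre) ?_ ?_ x
    · intro u hu; simp only [tau]; field_simp; ring
    · intro u hu
      simp only [hu, zero_mul, sub_zero, mul_one]
      exact hlre
    · intro u
      exact hmem u _ (by rw [hor]; simp [phi]; ring)
    · intro D hD hDo u u' hu hu' h h'
      exact joined_transversal _ hl0 D hD u u' hu hu' h h'
    · intro z hz
      exact ⟨(1, 1 - z / (ω * c)), one_ne_zero, by field_simp; ring⟩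

end PartF2

/-- Let `f₁` be a nonzero linear form and `f₂` an irreducible homogeneous
quadratic (so `V(f₂)` is a smooth conic). If `C₀, …, C_r` are distinct members
`C_i = V(a_i·f₂ + b_i·f₁²)` of the pencil `[f₂ : f₁²]`, each of which is a smooth conic
(i.e. the associated symmetric 3×3 matrix is invertible), then
`π₁(ℙ² \ (C₀ ∪ ⋯ ∪ C_r)) ≅ 𝔽_r * ℤ₂`. -/
theorem stmt_10 (f₁ f₂ : MvPolynomial (Fin 3) ℂ)
    (hf₁0 : f₁ ≠ 0) (hf₁ : f₁.IsHomogeneous 1)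
    (hf₂ : f₂.IsHomogeneous 2) (hf₂irr : Irreducible f₂)
    (r : ℕ) (a b : Fin (r + 1) → ℂ) (hab : ∀ i, ![a i, b i] ≠ 0)
    (hdist : Function.Injective (fun i => pt (a i) (b i) (hab i)))
    -- each member of the pencil is a smooth conic: its symmetric matrix is invertible
    (hsmooth : ∀ i, ∃ M : Matrix (Fin 3) (Fin 3) ℂ, M.IsSymm ∧ M.det ≠ 0 ∧
      C (a i) * f₂ + C (b i) * f₁ ^ 2 = ∑ j : Fin 3, ∑ k : Fin 3, C (M j k) * (X j * X k)) :
    ∀ x : ↥(⋃ i, V (C (a i) * f₂ + C (b i) * f₁ ^ 2))ᶜ,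
      Nonempty (FundamentalGroup (↥(⋃ i, V (C (a i) * f₂ + C (b i) * f₁ ^ 2))ᶜ) x ≃*
        Monoid.Coprod (FreeGroup (Fin r)) (Multiplicative (ZMod 2))) := by
  intro x
  obtain ⟨d, hd⟩ := eval_linear f₁ hf₁
  have hd0 : d ≠ 0 := fun h => by
    apply hf₁0
    apply MvPolynomial.funext
    intro v
    rw [hd, h]; simp
  choose M hM hMd hMe using hsmooth
  have hev : ∀ i v, eval v (C (a i) * f₂ + C (b i) * f₁ ^ 2) = qf (M i) v := fun i v => by
    rw [hMe]; simp [qf]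
  refine final d hd0 (fun v => eval v f₂) a b ?_ M hM hMd ?_ _ ?_ x
  · intro i j hi hj hij
    apply hdist
    refine (Projectivization.mk_eq_mk_iff' ℂ _ _ _ _).2 ⟨a i / a j, ?_⟩
    ext k
    fin_cases k
    · simp; field_simp
    · simp; field_simp; linear_combination hij
  · intro i v
    rw [← hev]; simp [hd]
  · intro v hv
    rw [Set.mem_compl_iff, Set.mem_iUnion, not_exists]
    refine forall_congr' fun i => not_congr ?_
    show eval (Projectivization.mk ℂ v hv).rep _ = 0 ↔ _
    rw [hev]
    obtain ⟨t, ht⟩ := Projectivization.exists_smul_eq_mk_rep ℂ v hv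
    rw [← ht, Units.smul_def, qf_smul]
    simp
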